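/- arXiv:1807.04069 — 9 statements merged into one kernel-verified Lean document; each statement's English description precedes it below -/
import Mathlib

section
/- Let F = RatFunc ℝ, let G : Matrix (Fin p) (Fin m) F, let S ⊆ Fin m, and let i ∈ S. Then a perfectly undetectable attack supported on S and active in i exists if and only if the rank over F of the submatrix of G formed by the columns in S equals the rank over F of the submatrix of G formed by the columns in S \ {i} (i.e., normrank G^(S) = normrank G^(S \ i)). -/
/-- A perfectly undetectable attack on the transfer matrix `G`, supported on the set of
components `S` and active in component `i`: a vector in the kernel of `G` (over the field
of real rational functions) vanishing outside `S` and nonzero at `i`. -/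
def PerfectlyUndetectableAttack {p m : ℕ} (G : Matrix (Fin p) (Fin m) (RatFunc ℝ))
    (S : Finset (Fin m)) (i : Fin m) : Prop :=
  ∃ v : Fin m → RatFunc ℝ, (∀ j ∉ S, v j = 0) ∧ v i ≠ 0 ∧ G.mulVec v = 0

/-- The rank of the submatrix formed by a finite set of columns is the dimension of the span
of these columns. -/
theorem rank_submatrix_finset_eq_finrank_span {K m n : Type*} [Field K]
    (G : Matrix m n K) (S : Finset n) :
    (G.submatrix id (fun j : {x // x ∈ S} => (j : n))).rank =
      Module.finrank K (Submodule.span K (G.col '' (S : Set n))) := by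
  rw [Matrix.rank_eq_finrank_span_cols, Set.image_eq_range]
  rfl

/-- Removing a column keeps the rank exactly when this column is in the span of the others. -/
theorem rank_submatrix_eq_rank_erase_iff {K m n : Type*} [Field K] [Finite m] [DecidableEq n]
    (G : Matrix m n K) {S : Finset n} {i : n} (hi : i ∈ S) :
    (G.submatrix id (fun j : {x // x ∈ S} => (j : n))).rank =
        (G.submatrix id (fun j : {x // x ∈ S.erase i} => (j : n))).rank ↔
      G.col i ∈ Submodule.span K (G.col '' (S.erase i : Set n)) := by
  rw [rank_submatrix_finset_eq_finrank_span, rank_submatrix_finset_eq_finrank_span]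
  have hS : G.col '' (S : Set n) = insert (G.col i) (G.col '' (S.erase i : Set n)) := by
    rw [← Set.image_insert_eq, ← Finset.coe_insert, Finset.insert_erase hi]
  constructor
  · intro h
    rw [Submodule.eq_of_le_of_finrank_eq
      (Submodule.span_mono (Set.image_mono (Finset.coe_subset.2 (S.erase_subset i)))) h.symm]
    exact Submodule.subset_span ⟨i, hi, rfl⟩
  · intro h
    rw [hS, Submodule.span_insert_eq_span h]

/-- A kernel vector supported on `S` and nonzero at `i` exists exactly when column `i` is in the
span of the other columns of `S`. -/
theorem exists_mulVec_eq_zero_iff_col_mem_span {K m n : Type*} [Field K] [Fintype n]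
    [DecidableEq n] (G : Matrix m n K) {S : Finset n} {i : n} (hi : i ∈ S) :
    (∃ v : n → K, (∀ j ∉ S, v j = 0) ∧ v i ≠ 0 ∧ G.mulVec v = 0) ↔
      G.col i ∈ Submodule.span K (G.col '' (S.erase i : Set n)) := by
  have key : ∀ v : n → K, (∀ j ∉ S, v j = 0) →
      G.mulVec v = v i • G.col i + ∑ j ∈ S.erase i, v j • G.col j := by
    intro v hv
    rw [Finset.add_sum_erase S (fun j => v j • G.col j) hi,
      Finset.sum_subset S.subset_univ (fun j _ hj => by rw [hv j hj, zero_smul])]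
    ext k
    simp [Matrix.mulVec, dotProduct, mul_comm]
  constructor
  · rintro ⟨v, hv, hvi, h⟩
    rw [key v hv] at h
    have hmem : v i • G.col i ∈ Submodule.span K (G.col '' (S.erase i : Set n)) := by
      rw [eq_neg_of_add_eq_zero_left h]
      exact neg_mem (Submodule.sum_mem _ fun j hj =>
        Submodule.smul_mem _ _ (Submodule.subset_span ⟨j, hj, rfl⟩))
    exact (Submodule.smul_mem_iff _ hvi).1 hmem
  · intro h
    obtain ⟨c, hc⟩ := (Submodule.mem_span_image_finset_iff_exists_fun' K).1 h
    have hv : ∀ j ∉ S, (if j = i then -1 else if j ∈ S then c j else 0) = (0 : K) := by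
      intro j hj
      rw [if_neg (fun hji : j = i => hj (hji ▸ hi)), if_neg hj]
    refine ⟨_, hv, by simp, ?_⟩
    rw [key _ hv, Finset.sum_congr rfl (g := fun j => c j • G.col j), hc]
    · simp
    · intro j hj
      rw [if_neg (Finset.ne_of_mem_erase hj), if_pos (Finset.mem_of_mem_erase hj)]

/-- Proposition 1: a perfectly undetectable attack supported on `S` and active in `i ∈ S`
exists iff the normal rank of the column submatrix `G^(S)` equals that of `G^(S \ i)`. -/
theorem perfectlyUndetectable_iff_normrank_eq {p m : ℕ}
    (G : Matrix (Fin p) (Fin m) (RatFunc ℝ)) (S : Finset (Fin m)) (i : Fin m)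
    (hi : i ∈ S) :
    PerfectlyUndetectableAttack G S i ↔
      (G.submatrix id (fun j : {x // x ∈ S} => (j : Fin m))).rank =
        (G.submatrix id (fun j : {x // x ∈ S.erase i} => (j : Fin m))).rank := by
  rw [rank_submatrix_eq_rank_erase_iff G hi]
  exact exists_mulVec_eq_zero_iff_col_mem_span G hi
end

section
/- (Effect of deploying a new unprotected sensor.) Let F = RatFunc ℝ, G : Matrix (Fin p) (Fin m) F, and i : Fin m. Let G' : Matrix (Fin (p+1)) (Fin (m+1)) F be obtained from G by appending one new row r : Fin m → F (in the first m columns) together with one new column whose entries are 0 in the first p rows and 1 in the new row (the attack channel of the new unprotected sensor). Then δ_G(i) ≤ δ_{G'}(i) ≤ δ_G(i) + 1, with the convention (+∞) + 1 = +∞, where i is viewed as one of the first m column indices of G'. -/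
/-- The security index `δ_G(i)`: the minimum cardinality of a set `S ∋ i` admitting a
perfectly undetectable attack supported on `S` and active in `i`; `+∞` if none exists. -/
noncomputable def secIndex {p m : ℕ} (G : Matrix (Fin p) (Fin m) (RatFunc ℝ))
    (i : Fin m) : ℕ∞ :=
  sInf {n : ℕ∞ | ∃ S : Finset (Fin m),
    i ∈ S ∧ PerfectlyUndetectableAttack G S i ∧ n = S.card}

theorem secIndex_le_card {p m : ℕ} {G : Matrix (Fin p) (Fin m) (RatFunc ℝ)}
    {S : Finset (Fin m)} {i : Fin m} (hi : i ∈ S)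
    (hS : PerfectlyUndetectableAttack G S i) : secIndex G i ≤ S.card :=
  sInf_le ⟨S, hi, hS, rfl⟩

/-- Unless it is infinite, the security index is attained by some support. -/
theorem secIndex_eq_top_or_exists_card {p m : ℕ} (G : Matrix (Fin p) (Fin m) (RatFunc ℝ))
    (i : Fin m) :
    secIndex G i = ⊤ ∨ ∃ S : Finset (Fin m),
      i ∈ S ∧ PerfectlyUndetectableAttack G S i ∧ secIndex G i = S.card := by
  rcases Set.eq_empty_or_nonempty {n : ℕ∞ | ∃ S : Finset (Fin m),
    i ∈ S ∧ PerfectlyUndetectableAttack G S i ∧ n = S.card} with h | h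
  · left
    rw [secIndex, h, sInf_empty]
  · exact Or.inr (csInf_mem h)

/-- Adding a new unprotected sensor (a new row `r`, together with a new attack column which
is the indicator of the new row) increases the security index of an actuator `i` by at most
one, and cannot decrease it: `δ_G(i) ≤ δ_{G'}(i) ≤ δ_G(i) + 1`. -/
theorem secIndex_new_unprotected_sensor {p m : ℕ}
    (G : Matrix (Fin p) (Fin m) (RatFunc ℝ)) (r : Fin m → RatFunc ℝ) (i : Fin m)
    (G' : Matrix (Fin (p + 1)) (Fin (m + 1)) (RatFunc ℝ))
    (h1 : ∀ (a : Fin p) (b : Fin m), G' a.castSucc b.castSucc = G a b)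
    (h2 : ∀ b : Fin m, G' (Fin.last p) b.castSucc = r b)
    (h3 : ∀ a : Fin p, G' a.castSucc (Fin.last m) = 0)
    (h4 : G' (Fin.last p) (Fin.last m) = 1) :
    secIndex G i ≤ secIndex G' i.castSucc ∧
      secIndex G' i.castSucc ≤ secIndex G i + 1 := by
  constructor
  · refine le_sInf ?_
    rintro _ ⟨S, hi, ⟨v, hv, hvi, hGv⟩, rfl⟩
    let T : Finset (Fin m) := Finset.univ.filter fun j => j.castSucc ∈ S
    have hT : PerfectlyUndetectableAttack G T i := by
      refine ⟨fun j => v j.castSucc, fun j hj => hv _ (by simpa [T] using hj), hvi, ?_⟩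
      ext a
      have ha := congrFun hGv a.castSucc
      simpa [Matrix.mulVec, dotProduct, Fin.sum_univ_castSucc, h1, h3] using ha
    refine (secIndex_le_card (by simpa [T] using hi) hT).trans ?_
    have hsub : T.map Fin.castSuccEmb ⊆ S := by
      intro j hj
      obtain ⟨b, hb, rfl⟩ := Finset.mem_map.mp hj
      simpa [T] using hb
    have hcard := Finset.card_le_card hsub
    rw [Finset.card_map] at hcard
    exact_mod_cast hcard
  · rcases secIndex_eq_top_or_exists_card G i with h | ⟨S, hi, ⟨v, hv, hvi, hGv⟩, h⟩
    · simp [h]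
    let T : Finset (Fin (m + 1)) := insert (Fin.last m) (S.map Fin.castSuccEmb)
    have hT : PerfectlyUndetectableAttack G' T i.castSucc := by
      refine ⟨Fin.snoc (α := fun _ => RatFunc ℝ) v (-(r ⬝ᵥ v)), ?_, by simpa using hvi, ?_⟩
      · intro j hj
        cases j using Fin.lastCases with
        | last => simp [T] at hj
        | cast b =>
          rw [Fin.snoc_castSucc]
          exact hv b fun hb => hj (Finset.mem_insert_of_mem
            (Finset.mem_map_of_mem Fin.castSuccEmb hb))
      · ext a
        cases a using Fin.lastCases with
        | last => simp [Matrix.mulVec, dotProduct, Fin.sum_univ_castSucc, h2, h4]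
        | cast a =>
          have ha := congrFun hGv a
          simpa [Matrix.mulVec, dotProduct, Fin.sum_univ_castSucc, h1, h3] using ha
    have hiT : i.castSucc ∈ T :=
      Finset.mem_insert_of_mem (Finset.mem_map_of_mem Fin.castSuccEmb hi)
    refine (secIndex_le_card hiT hT).trans ?_
    have hcard := Finset.card_insert_le (Fin.last m) (S.map Fin.castSuccEmb)
    rw [Finset.card_map] at hcard
    rw [h]
    exact_mod_cast hcard
end

section
/- Let (U_a, Y_a) be sets of attacked actuators and attacked sensors with u_i ∈ U_a and Y_a ∩ P = ∅, and let X_a be the set of state vertices x_p such that [B] p k = true for some actuator u_k ∈ U_a \ {u_i}. If X_a ∪ Y_a is a vertex separator of u_i and t in the extended graph G_t, then for every realization (A, B, C) of the structural model there exists a perfectly undetectable attack using (U_a, Y_a) and active in u_i; consequently δ(u_i) ≤ |U_a| + |Y_a| for every realization. -/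
/-- Vertices of the extended graph `G_t`: actuators, states, sensors, and the sink `t`. -/
inductive Vertex (nx nu ns : ℕ) where
  | act : Fin nu → Vertex nx nu ns
  | st  : Fin nx → Vertex nx nu ns
  | sen : Fin ns → Vertex nx nu ns
  | t   : Vertex nx nu ns

/-- Edges of the extended graph `G_t` of the structural model `([A], [B], [C])`:
`u_j → x_p` iff `[B] p j`, `x_q → x_p` iff `[A] p q`, `x_p → y_l` iff `[C] l p`,
and `y_l → t` for every sensor `y_l`. -/
def edgeRel {nx nu ns : ℕ} (Ab : Fin nx → Fin nx → Bool) (Bb : Fin nx → Fin nu → Bool)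
    (Cb : Fin ns → Fin nx → Bool) : Vertex nx nu ns → Vertex nx nu ns → Prop
  | Vertex.act j, Vertex.st p => Bb p j = true
  | Vertex.st q, Vertex.st p => Ab p q = true
  | Vertex.st p, Vertex.sen l => Cb l p = true
  | Vertex.sen _, Vertex.t => True
  | _, _ => False

/-- `S` is a vertex separator of `a` and `b` (with respect to the edge relation `E`):
`S` avoids `a` and `b`, and every directed path from `a` to `b` contains a vertex of `S`.
A directed path from `a` to `b` is encoded by a list `l` with `List.Chain E a l` and
last element `b`. -/
def IsVertexSeparator {V : Type*} (E : V → V → Prop) (a b : V) (S : Set V) : Prop :=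
  a ∉ S ∧ b ∉ S ∧
    ∀ l : List V, List.Chain E a l → l.getLast? = some b → ∃ v ∈ l, v ∈ S

/-- Standing structural assumptions: each column of `[B]` is a standard basis vector,
distinct columns of `[B]` are distinct, and each row of `[C]` is a standard basis vector. -/
def StructAssumption {nx nu ns : ℕ} (Bb : Fin nx → Fin nu → Bool)
    (Cb : Fin ns → Fin nx → Bool) : Prop :=
  (∀ j, ∃! p, Bb p j = true) ∧
    (∀ j j' : Fin nu, (∀ p, Bb p j = Bb p j') → j = j') ∧
    (∀ l, ∃! p, Cb l p = true)

/-- A realization `(A, B, C)` of the structural model `([A], [B], [C])`. -/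
structure Realization {nx nu ns : ℕ} (Ab : Fin nx → Fin nx → Bool)
    (Bb : Fin nx → Fin nu → Bool) (Cb : Fin ns → Fin nx → Bool) where
  A : Matrix (Fin nx) (Fin nx) ℝ
  B : Matrix (Fin nx) (Fin nu) ℝ
  C : Matrix (Fin ns) (Fin nx) ℝ
  hA : ∀ p q, Ab p q = false → A p q = 0
  hB0 : ∀ p j, Bb p j = false → B p j = 0
  hB1 : ∀ p j, Bb p j = true → B p j ≠ 0
  hC : ∀ l p, Cb l p = false → C l p = 0

/-- A perfectly undetectable attack on the realization `R`, using attacked actuators `Ua`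
and attacked sensors `Ya`, and actively using actuator `i`: starting from `x 0 = 0` (and
zero control input), the attack signals drive the dynamics while all measurements remain
identically zero, and the attack signal on actuator `i` is not identically zero. -/
def PUAttack {nx nu ns : ℕ} {Ab : Fin nx → Fin nx → Bool} {Bb : Fin nx → Fin nu → Bool}
    {Cb : Fin ns → Fin nx → Bool} (R : Realization Ab Bb Cb)
    (Ua : Finset (Fin nu)) (Ya : Finset (Fin ns)) (i : Fin nu) : Prop :=
  ∃ (au : ℕ → Fin nu → ℝ) (ay : ℕ → Fin ns → ℝ) (x : ℕ → Fin nx → ℝ),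
    x 0 = 0 ∧
    (∀ k, x (k + 1) = R.A.mulVec (x k) + R.B.mulVec (au k)) ∧
    (∀ k, R.C.mulVec (x k) + ay k = 0) ∧
    (∀ k, ∀ j ∉ Ua, au k j = 0) ∧
    (∀ k, ∀ l ∉ Ya, ay k l = 0) ∧
    (∃ k, au k i ≠ 0)

/-- The candidate separator associated with attacked components `(Ua, Ya)` and actuator `i`:
the states `X_a` directly driven by an attacked actuator other than `u_i`, together with
the attacked sensors `Y_a`. -/
def sepSet {nx nu ns : ℕ} (Bb : Fin nx → Fin nu → Bool)
    (Ua : Finset (Fin nu)) (Ya : Finset (Fin ns)) (i : Fin nu) :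
    Set (Vertex nx nu ns) :=
  {v | (∃ p : Fin nx, v = Vertex.st p ∧ ∃ k ∈ Ua, k ≠ i ∧ Bb p k = true) ∨
    (∃ l ∈ Ya, v = Vertex.sen l)}

/-- The security index `δ(u_i)` of actuator `i` in the realization `R` with protected
sensors `P`: the minimum of `|Ua| + |Ya|` over pairs of attacked actuators and attacked
unprotected sensors admitting a perfectly undetectable attack active in `i`. -/
noncomputable def deltaIdx {nx nu ns : ℕ} {Ab : Fin nx → Fin nx → Bool}
    {Bb : Fin nx → Fin nu → Bool} {Cb : Fin ns → Fin nx → Bool}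
    (R : Realization Ab Bb Cb) (P : Set (Fin ns)) (i : Fin nu) : ℕ∞ :=
  sInf {n : ℕ∞ | ∃ (Ua : Finset (Fin nu)) (Ya : Finset (Fin ns)),
    i ∈ Ua ∧ (∀ l ∈ Ya, l ∉ P) ∧ PUAttack R Ua Ya i ∧ n = Ua.card + Ya.card}

/-- The robust security index `δ_r(u_i)`: the minimum of `|Ua| + |Ya|` over pairs
`(Ua, Ya)` with `i ∈ Ua` and `Ya` unprotected such that `X_a ∪ Y_a` is a vertex separator
of `u_i` and `t` in the extended graph. -/
noncomputable def deltaR {nx nu ns : ℕ} (Ab : Fin nx → Fin nx → Bool)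
    (Bb : Fin nx → Fin nu → Bool) (Cb : Fin ns → Fin nx → Bool)
    (P : Set (Fin ns)) (i : Fin nu) : ℕ∞ :=
  sInf {n : ℕ∞ | ∃ (Ua : Finset (Fin nu)) (Ya : Finset (Fin ns)),
    i ∈ Ua ∧ (∀ l ∈ Ya, l ∉ P) ∧
    IsVertexSeparator (edgeRel Ab Bb Cb) (Vertex.act i) Vertex.t (sepSet Bb Ua Ya i) ∧
    n = Ua.card + Ya.card}

/-- A vertex separator of `a` and `b` cuts every walk from `a` to `b` that avoids it. -/
theorem IsVertexSeparator.not_reflTransGen {V : Type*} {E : V → V → Prop} {a b : V} {S : Set V}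
    (h : IsVertexSeparator E a b S) (hab : a ≠ b) :
    ¬ Relation.ReflTransGen (fun v w => E v w ∧ w ∉ S) a b := by
  intro hr
  have key : ∀ c, Relation.ReflTransGen (fun v w => E v w ∧ w ∉ S) a c → ∃ l : List V,
      List.IsChain E (a :: l) ∧ (a :: l).getLast? = some c ∧ ∀ v ∈ l, v ∉ S := by
    intro c hc
    induction hc with
    | refl => exact ⟨[], by simp⟩
    | @tail c d _ hcd ih =>
      obtain ⟨l, hl, hlast, hS⟩ := ih
      refine ⟨l ++ [d], ?_, by rw [← List.cons_append, List.getLast?_concat], ?_⟩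
      · rw [← List.cons_append, List.isChain_append]
        refine ⟨hl, by simp, ?_⟩
        simp_all
      · intro v hv
        rcases List.mem_append.1 hv with hv | hv
        · exact hS v hv
        · rw [List.mem_singleton.1 hv]
          exact hcd.2
  obtain ⟨l, hl, hlast, hS⟩ := key b hr
  have hne : l ≠ [] := by
    rintro rfl
    exact hab (by simpa using hlast)
  obtain ⟨v, hv, hvS⟩ := h.2.2 l hl (by
    rw [← hlast, List.getLast?_cons_of_ne_nil hne])
  exact hS v hv hvS

theorem exists_mul_ne_zero_of_mulVec_ne_zero {m n α : Type*} [Fintype n]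
    [NonUnitalNonAssocSemiring α] {M : Matrix m n α} {v : n → α} {r : m} (h : M.mulVec v r ≠ 0) :
    ∃ q, M r q * v q ≠ 0 := by
  rw [Matrix.mulVec, dotProduct] at h
  obtain ⟨q, -, hq⟩ := Finset.exists_ne_zero_of_sum_ne_zero h
  exact ⟨q, hq⟩

theorem mulVec_apply_eq_mul {m n α : Type*} [Fintype n] [NonUnitalNonAssocSemiring α]
    {M : Matrix m n α} {v : n → α} {r : m} (c : n) (h : ∀ q, q ≠ c → M r q * v q = 0) :
    M.mulVec v r = M r c * v c :=
  Finset.sum_eq_single c (fun q _ => h q) (by simp)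

section Attack

variable {nx nu ns : ℕ} {Ab : Fin nx → Fin nx → Bool} {Bb : Fin nx → Fin nu → Bool}
  {Cb : Fin ns → Fin nx → Bool}

open Classical in
/-- The state trajectory produced by an impulse on actuator `i` at time `0`, when the states
driven by the actuators in `Ua` other than `i` are held at zero. -/
noncomputable def clampedTrajectory (R : Realization Ab Bb Cb) (Ua : Finset (Fin nu))
    (i : Fin nu) : ℕ → Fin nx → ℝ
  | 0 => 0
  | k + 1 => fun p =>
      if ∃ j ∈ Ua, j ≠ i ∧ Bb p j = true then 0
      else R.A.mulVec (clampedTrajectory R Ua i k) p + R.B p i * (if k = 0 then 1 else 0)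

theorem clampedTrajectory_succ_of_driven {R : Realization Ab Bb Cb} {Ua : Finset (Fin nu)}
    {i : Fin nu} {p : Fin nx} (hp : ∃ j ∈ Ua, j ≠ i ∧ Bb p j = true) (k : ℕ) :
    clampedTrajectory R Ua i (k + 1) p = 0 :=
  if_pos hp

theorem clampedTrajectory_succ_of_not_driven {R : Realization Ab Bb Cb} {Ua : Finset (Fin nu)}
    {i : Fin nu} {p : Fin nx} (hp : ¬ ∃ j ∈ Ua, j ≠ i ∧ Bb p j = true) (k : ℕ) :
    clampedTrajectory R Ua i (k + 1) p =
      R.A.mulVec (clampedTrajectory R Ua i k) p + R.B p i * (if k = 0 then 1 else 0) :=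
  if_neg hp

/-- The clamped trajectory is supported on the states reachable from `i` without meeting the
separating set. -/
theorem reflTransGen_of_clampedTrajectory_ne_zero (R : Realization Ab Bb Cb)
    (Ua : Finset (Fin nu)) (Ya : Finset (Fin ns)) (i : Fin nu) (k : ℕ) (p : Fin nx)
    (hx : clampedTrajectory R Ua i k p ≠ 0) :
    Relation.ReflTransGen (fun v w => edgeRel Ab Bb Cb v w ∧ w ∉ sepSet Bb Ua Ya i)
      (Vertex.act i) (Vertex.st p) := by
  induction k generalizing p with
  | zero => simp [clampedTrajectory] at hx
  | succ k ih =>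
    by_cases hp : ∃ j ∈ Ua, j ≠ i ∧ Bb p j = true
    · exact absurd (clampedTrajectory_succ_of_driven hp k) hx
    have hpS : (Vertex.st p : Vertex nx nu ns) ∉ sepSet Bb Ua Ya i := by
      rintro (⟨q, hq, h⟩ | ⟨l, _, hl⟩)
      · cases hq
        exact hp h
      · cases hl
    by_cases hB : Bb p i = true
    · exact .single ⟨hB, hpS⟩
    have hA : R.A.mulVec (clampedTrajectory R Ua i k) p ≠ 0 := by
      simpa [clampedTrajectory_succ_of_not_driven hp, R.hB0 p i (by simpa using hB)] using hx
    obtain ⟨q, hq⟩ := exists_mul_ne_zero_of_mulVec_ne_zero hA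
    refine (ih q (right_ne_zero_of_mul hq)).tail ⟨?_, hpS⟩
    by_contra hAb
    exact left_ne_zero_of_mul hq (R.hA p q (by simpa [edgeRel] using hAb))

/-- Each actuator drives a single state, and distinct actuators drive distinct states. -/
theorem StructAssumption.exists_injective (h : StructAssumption Bb Cb) :
    ∃ d : Fin nu → Fin nx, d.Injective ∧ ∀ p j, Bb p j = true ↔ p = d j := by
  choose d hd hu using h.1
  have hiff : ∀ p j, Bb p j = true ↔ p = d j := fun p j =>
    ⟨hu j p, fun hp => hp ▸ hd j⟩
  refine ⟨d, fun j j' hj => h.2.1 j j' fun p => ?_, hiff⟩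
  rw [Bool.eq_iff_iff, hiff, hiff, hj]

/-- If `X_a ∪ Y_a` separates `u_i` from `t`, every realization admits a perfectly undetectable
attack active in `u_i`. -/
theorem puAttack_of_isVertexSeparator (hstruct : StructAssumption Bb Cb)
    {Ua : Finset (Fin nu)} {Ya : Finset (Fin ns)} {i : Fin nu} (hi : i ∈ Ua)
    (hsep : IsVertexSeparator (edgeRel Ab Bb Cb) (Vertex.act i) Vertex.t (sepSet Bb Ua Ya i))
    (R : Realization Ab Bb Cb) : PUAttack R Ua Ya i := by
  classical
  obtain ⟨d, hinj, hd⟩ := hstruct.exists_injective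
  have hB0 : ∀ p j, p ≠ d j → R.B p j = 0 := fun p j hp =>
    R.hB0 p j (by rwa [← Bool.not_eq_true, hd])
  have hB1 : ∀ j, R.B (d j) j ≠ 0 := fun j => R.hB1 _ j ((hd _ _).2 rfl)
  set x := clampedTrajectory R Ua i with hxdef
  refine ⟨fun k j => if j = i then (if k = 0 then 1 else 0)
      else if j ∈ Ua then -R.A.mulVec (x k) (d j) / R.B (d j) j else 0,
    fun k => -R.C.mulVec (x k), x, rfl, fun k => funext fun p => ?_,
    fun k => add_neg_cancel _, fun k j hj => ?_, fun k l hl => ?_, 0, by simp⟩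
  · rw [Pi.add_apply]
    by_cases hp : ∃ j ∈ Ua, j ≠ i ∧ Bb p j = true
    · rw [hxdef, clampedTrajectory_succ_of_driven hp, ← hxdef]
      obtain ⟨j, hj, hji, hpj⟩ := hp
      obtain rfl := (hd p j).1 hpj
      rw [mulVec_apply_eq_mul (M := R.B) j]
      · simp only [if_neg hji, if_pos hj]
        rw [mul_div_cancel₀ _ (hB1 j)]
        exact (add_neg_cancel _).symm
      · intro j' hne
        rw [hB0 _ _ fun h => hne (hinj h).symm, zero_mul]
    · rw [hxdef, clampedTrajectory_succ_of_not_driven hp, ← hxdef]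
      congr 1
      rw [mulVec_apply_eq_mul (M := R.B) i]
      · simp
      · intro j hji
        by_cases hj : j ∈ Ua
        · rw [hB0 p j fun h => hp ⟨j, hj, hji, (hd p j).2 h⟩, zero_mul]
        · simp [hji, hj]
  · have hji : j ≠ i := fun h => hj (h ▸ hi)
    simp [hji, hj]
  · by_contra hne
    have hC : R.C.mulVec (x k) l ≠ 0 := by simpa using hne
    obtain ⟨p, hp⟩ := exists_mul_ne_zero_of_mulVec_ne_zero hC
    have hCb : Cb l p = true := by
      by_contra h
      exact left_ne_zero_of_mul hp (R.hC l p (by simpa using h))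
    have hlS : (Vertex.sen l : Vertex nx nu ns) ∉ sepSet Bb Ua Ya i := by
      rintro (⟨q, hq, _⟩ | ⟨l', hl', h⟩)
      · cases hq
      · cases h
        exact hl hl'
    have hr := reflTransGen_of_clampedTrajectory_ne_zero R Ua Ya i k p (right_ne_zero_of_mul hp)
    exact hsep.not_reflTransGen (by simp) <|
      (hr.tail (c := Vertex.sen l) ⟨hCb, hlS⟩).tail ⟨trivial, hsep.2.1⟩

end Attack

/-- Theorem 2: if `X_a ∪ Y_a` is a vertex separator of `u_i` and `t` in the extended
graph, then in every realization of the structural model there exists a perfectly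
undetectable attack using `(Ua, Ya)` and active in `u_i`; consequently
`δ(u_i) ≤ |Ua| + |Ya|` for every realization. -/
theorem separator_implies_attack_and_deltaIdx_le {nx nu ns : ℕ}
    (Ab : Fin nx → Fin nx → Bool) (Bb : Fin nx → Fin nu → Bool)
    (Cb : Fin ns → Fin nx → Bool) (P : Set (Fin ns))
    (hstruct : StructAssumption Bb Cb)
    (Ua : Finset (Fin nu)) (Ya : Finset (Fin ns)) (i : Fin nu)
    (hi : i ∈ Ua) (hYa : ∀ l ∈ Ya, l ∉ P)
    (hsep : IsVertexSeparator (edgeRel Ab Bb Cb) (Vertex.act i) Vertex.t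
      (sepSet Bb Ua Ya i)) :
    ∀ R : Realization Ab Bb Cb,
      PUAttack R Ua Ya i ∧ deltaIdx R P i ≤ ((Ua.card + Ya.card : ℕ) : ℕ∞) := by
  intro R
  have hatt := puAttack_of_isVertexSeparator hstruct hi hsep R
  exact ⟨hatt, sInf_le ⟨Ua, Ya, hi, hYa, hatt, by push_cast; rfl⟩⟩
end

section
/- Let (U_a, Y_a) be sets of attacked actuators and attacked sensors with u_i ∈ U_a and Y_a ∩ P = ∅, and let X_a be the set of state vertices x_p such that [B] p k = true for some actuator u_k ∈ U_a \ {u_i}. If X_a ∪ Y_a is not a vertex separator of u_i and t in the extended graph G_t, then there exists a realization (A, B, C) of the structural model for which no perfectly undetectable attack using (U_a, Y_a) and active in u_i exists. -/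
/-- Vertices reachable from `a` carry a parent function along which a depth strictly decreases. -/
theorem exists_parent_of_reflTransGen {V : Type*} (r : V → V → Prop) (a : V) :
    ∃ (par : V → V) (d : V → ℕ), ∀ p, Relation.ReflTransGen r a p → p ≠ a →
      r (par p) p ∧ Relation.ReflTransGen r a (par p) ∧ d (par p) < d p := by
  classical
  let lvl : ℕ → V → Prop :=
    Nat.rec (fun p => p = a) (fun _ L p => ∃ q, L q ∧ r q p)
  have lvl_reach : ∀ n p, lvl n p → Relation.ReflTransGen r a p := by
    intro n
    induction n with
    | zero => exact fun p (h : p = a) => h ▸ .refl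
    | succ n ih => rintro p ⟨q, hq, hr⟩; exact (ih q hq).tail hr
  have reach_lvl : ∀ p, Relation.ReflTransGen r a p → ∃ n, lvl n p := by
    intro p h
    induction h with
    | refl => exact ⟨0, rfl⟩
    | tail _ hr ih => obtain ⟨n, hn⟩ := ih; exact ⟨n + 1, _, hn, hr⟩
  have step : ∀ p, ∃ q, Relation.ReflTransGen r a p → p ≠ a →
      r q p ∧ Relation.ReflTransGen r a q ∧ sInf {n | lvl n q} < sInf {n | lvl n p} := by
    intro p
    by_cases h : Relation.ReflTransGen r a p ∧ p ≠ a
    · have hm : lvl (sInf {n | lvl n p}) p := Nat.sInf_mem (s := {n | lvl n p}) (reach_lvl p h.1)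
      rcases hd : sInf {n | lvl n p} with _ | m
      · rw [hd] at hm
        exact absurd hm h.2
      · rw [hd] at hm
        obtain ⟨q, hq, hr⟩ := hm
        exact ⟨q, fun _ _ => ⟨hr, lvl_reach m q hq, Nat.lt_succ_of_le (Nat.sInf_le hq)⟩⟩
    · exact ⟨p, fun h₁ h₂ => absurd ⟨h₁, h₂⟩ h⟩
  choose par hpar using step
  exact ⟨par, fun p => sInf {n | lvl n p}, hpar⟩

/-- A path in `G_t` from a state to `t` avoiding `S` runs through states outside `S` and then
through a sensor outside `S`. -/
theorem exists_reachable_sensor_of_isChain {nx nu ns : ℕ} {Ab : Fin nx → Fin nx → Bool}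
    {Bb : Fin nx → Fin nu → Bool} {Cb : Fin ns → Fin nx → Bool} {S : Set (Vertex nx nu ns)}
    (l : List (Vertex nx nu ns)) (q : Fin nx)
    (hl : List.IsChain (edgeRel Ab Bb Cb) (Vertex.st q :: l))
    (hlast : l.getLast? = some Vertex.t) (hS : ∀ v ∈ l, v ∉ S) :
    ∃ p m, Relation.ReflTransGen (fun q p => Ab p q = true ∧ Vertex.st p ∉ S) q p ∧
      Cb m p = true ∧ Vertex.sen m ∉ S := by
  induction l generalizing q with
  | nil => simp at hlast
  | cons v l ih =>
    rw [List.isChain_cons_cons] at hl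
    obtain ⟨hqv, hl⟩ := hl
    have hv : v ∉ S := hS v (by simp)
    cases v with
    | act j => exact hqv.elim
    | t => exact hqv.elim
    | sen m => exact ⟨q, m, .refl, hqv, hv⟩
    | st p =>
      have hlast' : l.getLast? = some Vertex.t := by
        cases l with
        | nil => simp at hlast
        | cons w l => simpa using hlast
      obtain ⟨p', m, hr, hm, hmS⟩ := ih p hl hlast' fun w hw => hS w (by simp [hw])
      exact ⟨p', m, .head ⟨hqv, hv⟩ hr, hm, hmS⟩

/-- If `X_a ∪ Y_a` is not a vertex separator of `u_i` and `t` in the extended graph, then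
there exists a realization of the structural model in which no perfectly undetectable
attack using `(Ua, Ya)` and active in `u_i` exists. -/
theorem not_separator_implies_exists_realization_no_attack {nx nu ns : ℕ}
    (Ab : Fin nx → Fin nx → Bool) (Bb : Fin nx → Fin nu → Bool)
    (Cb : Fin ns → Fin nx → Bool) (P : Set (Fin ns))
    (hstruct : StructAssumption Bb Cb)
    (Ua : Finset (Fin nu)) (Ya : Finset (Fin ns)) (i : Fin nu)
    (hi : i ∈ Ua) (hYa : ∀ l ∈ Ya, l ∉ P)
    (hsep : ¬ IsVertexSeparator (edgeRel Ab Bb Cb) (Vertex.act i) Vertex.t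
      (sepSet Bb Ua Ya i)) :
    ∃ R : Realization Ab Bb Cb, ¬ PUAttack R Ua Ya i := by
  classical
  have hpath : ∃ l, List.IsChain (edgeRel Ab Bb Cb) (Vertex.act i :: l) ∧
      l.getLast? = some Vertex.t ∧ ∀ v ∈ l, v ∉ sepSet Bb Ua Ya i := by
    by_contra! h
    exact hsep ⟨by simp [sepSet], by simp [sepSet], h⟩
  obtain ⟨a, m, e, hai, haS, hreach, hme, hmS⟩ : ∃ a m e, Bb a i = true ∧
      Vertex.st a ∉ sepSet Bb Ua Ya i ∧
      Relation.ReflTransGen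
        (fun q p => Ab p q = true ∧ Vertex.st p ∉ sepSet Bb Ua Ya i) a e ∧
      Cb m e = true ∧ Vertex.sen m ∉ sepSet Bb Ua Ya i := by
    obtain ⟨l, hl, hlast, hS⟩ := hpath
    cases l with
    | nil => simp at hlast
    | cons v l =>
      rw [List.isChain_cons_cons] at hl
      cases v with
      | act j => exact hl.1.elim
      | sen j => exact hl.1.elim
      | t => exact hl.1.elim
      | st a =>
        have hlast' : l.getLast? = some Vertex.t := by
          cases l with
          | nil => simp at hlast
          | cons w l => simpa using hlast
        obtain ⟨e, m, hr, hm, hmS⟩ := exists_reachable_sensor_of_isChain l a hl.2 hlast'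
          fun w hw => hS w (by simp [hw])
        exact ⟨a, m, e, hl.1, hS _ (by simp), hr, hm, hmS⟩
  obtain ⟨par, d, hpar⟩ := exists_parent_of_reflTransGen
    (fun q p => Ab p q = true ∧ Vertex.st p ∉ sepSet Bb Ua Ya i) a
  set r : Fin nx → Fin nx → Prop :=
    fun q p => Ab p q = true ∧ Vertex.st p ∉ sepSet Bb Ua Ya i
  let R : Realization Ab Bb Cb :=
    { A := Matrix.of fun p q =>
        if Relation.ReflTransGen r a p ∧ p ≠ a ∧ q = par p then 1 else 0
      B := Matrix.of fun p j => if Bb p j = true then 1 else 0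
      C := Matrix.of fun l p => if l = m ∧ p = e then 1 else 0
      hA := by
        intro p q h
        rw [Matrix.of_apply, if_neg]
        rintro ⟨h₁, h₂, rfl⟩
        have := (hpar p h₁ h₂).1.1
        simp [h] at this
      hB0 := by intro p j h; simp [h]
      hB1 := by intro p j h; simp [h]
      hC := by
        intro l p h
        rw [Matrix.of_apply, if_neg]
        rintro ⟨rfl, rfl⟩
        simp [hme] at h }
  refine ⟨R, ?_⟩
  rintro ⟨au, ay, x, -, hx, hy, hau, hay, k₀, hk₀⟩
  have input_of_not_mem : ∀ p k, Vertex.st p ∉ sepSet Bb Ua Ya i →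
      R.B.mulVec (au k) p = if Bb p i = true then au k i else 0 := by
    intro p k hp
    simp only [R, Matrix.mulVec, dotProduct, Matrix.of_apply, ite_mul, one_mul, zero_mul]
    rw [Finset.sum_eq_single i]
    · intro j _ hj
      split_ifs with hb
      · exact hau k j fun hjU => hp (Or.inl ⟨p, rfl, j, hjU, hj, hb⟩)
      · rfl
    · simp
  have output_zero : ∀ k, x k e = 0 := by
    intro k
    have h₁ := congrFun (hy k) m
    have h₂ : ay k m = 0 := hay k m fun h => hmS (Or.inr ⟨m, h, rfl⟩)
    simpa [R, Matrix.mulVec, dotProduct, h₂] using h₁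
  have back : ∀ n p, d p = n → Relation.ReflTransGen r a p → (∀ k, x k p = 0) →
      ∀ k, x k a = 0 := by
    intro n
    induction n using Nat.strong_induction_on with
    | _ n ih =>
      intro p hn hp hzero
      by_cases hpa : p = a
      · exact hpa ▸ hzero
      · obtain ⟨hstep, hreach', hlt⟩ := hpar p hp hpa
        refine ih _ (hn ▸ hlt) (par p) rfl hreach' fun k => ?_
        have h := congrFun (hx k) p
        have hpi : ¬ Bb p i = true := fun hb => hpa ((hstruct.1 i).unique hb hai)
        rw [Pi.add_apply, input_of_not_mem p k hstep.2, if_neg hpi, hzero] at h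
        simpa [R, Matrix.mulVec, dotProduct, hp, hpa] using h.symm
  have ha := back _ e rfl hreach output_zero
  apply hk₀
  have h := congrFun (hx k₀) a
  rw [Pi.add_apply, input_of_not_mem a k₀ haS, if_pos hai, ha] at h
  simpa [R, Matrix.mulVec, dotProduct] using h.symm
end

section
/- Let (U_a, Y_a) be sets of attacked actuators and attacked sensors with u_i ∈ U_a and Y_a ∩ P = ∅. If for every realization (A, B, C) of the structural model there exists a perfectly undetectable attack using (U_a, Y_a) and active in u_i, then |U_a| + |Y_a| ≥ δ_r(u_i). -/
/-- `ReachIn r a n p`: there is an `r`-walk of length `n` from `a` to `p`. -/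
inductive ReachIn {α : Type*} (r : α → α → Prop) (a : α) : ℕ → α → Prop
  | refl : ReachIn r a 0 a
  | tail {n : ℕ} {q p : α} : ReachIn r a n q → r q p → ReachIn r a (n + 1) p

/-- A breadth-first search tree rooted at `a`: every vertex reachable from `a` other than `a`
has a reachable parent of smaller depth. -/
lemma exists_bfs_parent {α : Type*} (r : α → α → Prop) (a : α) :
    ∃ (d : α → ℕ) (parent : α → α), ∀ p, (∃ n, ReachIn r a n p) → p ≠ a →
      r (parent p) p ∧ (∃ n, ReachIn r a n (parent p)) ∧ d (parent p) < d p := by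
  classical
  let d : α → ℕ := fun p => sInf {n | ReachIn r a n p}
  have key : ∀ p, ∃ q, (∃ n, ReachIn r a n p) → p ≠ a →
      r q p ∧ (∃ n, ReachIn r a n q) ∧ d q < d p := by
    intro p
    by_cases hp : (∃ n, ReachIn r a n p) ∧ p ≠ a
    · obtain ⟨hp, hpa⟩ := hp
      have hd : ReachIn r a (d p) p := Nat.sInf_mem hp
      generalize hm : d p = m at hd
      cases hd with
      | refl => exact absurd rfl hpa
      | @tail n q _ hq hqp =>
        refine ⟨q, fun _ _ => ⟨hqp, ⟨n, hq⟩, ?_⟩⟩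
        exact Nat.lt_succ_of_le (Nat.sInf_le hq)
    · exact ⟨p, fun h1 h2 => absurd ⟨h1, h2⟩ hp⟩
  choose parent hparent using key
  exact ⟨d, parent, hparent⟩

/-- A path to the sink that starts at a state and avoids the separator candidate reaches an
unattacked sensor through states that are not driven by other attacked actuators. -/
lemma exists_unattacked_sensor_of_chain {nx nu ns : ℕ} {Ab : Fin nx → Fin nx → Bool}
    {Bb : Fin nx → Fin nu → Bool} {Cb : Fin ns → Fin nx → Bool}
    {Ua : Finset (Fin nu)} {Ya : Finset (Fin ns)} {i : Fin nu} {a : Fin nx}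
    (l : List (Vertex nx nu ns)) (p : Fin nx)
    (hp : ∃ n, ReachIn (fun q p => Ab p q = true ∧ Vertex.st p ∉ sepSet (ns := ns) Bb Ua Ya i)
      a n p)
    (hchain : List.IsChain (edgeRel Ab Bb Cb) (Vertex.st p :: l))
    (hlast : l.getLast? = some Vertex.t) (havoid : ∀ v ∈ l, v ∉ sepSet Bb Ua Ya i) :
    ∃ q s, (∃ n, ReachIn (fun q p => Ab p q = true ∧ Vertex.st p ∉ sepSet (ns := ns) Bb Ua Ya i)
      a n q) ∧ Cb s q = true ∧ s ∉ Ya := by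
  induction l generalizing p with
  | nil => simp at hlast
  | cons v l ih =>
    rw [List.isChain_cons_cons] at hchain
    obtain ⟨hedge, hchain⟩ := hchain
    have hv : v ∉ sepSet Bb Ua Ya i := havoid v (by simp)
    cases v with
    | act j => exact hedge.elim
    | t => exact hedge.elim
    | sen s => exact ⟨p, s, hp, hedge, fun hs => hv (Or.inr ⟨s, hs, rfl⟩)⟩
    | st q =>
      obtain ⟨n, hn⟩ := hp
      refine ih q ⟨n + 1, hn.tail ⟨hedge, hv⟩⟩ hchain ?_ fun w hw => havoid w (by simp [hw])
      cases l with
      | nil => simp at hlast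
      | cons w l => simpa using hlast

/-- If every realization admits an attack using `(Ua, Ya)` active in `i`, then the states driven
by the other attacked actuators and the attacked sensors separate `u_i` from the sink. -/
lemma isVertexSeparator_of_forall_attack {nx nu ns : ℕ} {Ab : Fin nx → Fin nx → Bool}
    {Bb : Fin nx → Fin nu → Bool} {Cb : Fin ns → Fin nx → Bool} (hstruct : StructAssumption Bb Cb)
    {Ua : Finset (Fin nu)} {Ya : Finset (Fin ns)} {i : Fin nu}
    (hall : ∀ R : Realization Ab Bb Cb, PUAttack R Ua Ya i) :
    IsVertexSeparator (edgeRel Ab Bb Cb) (Vertex.act i) Vertex.t (sepSet Bb Ua Ya i) := by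
  classical
  refine ⟨by simp [sepSet], by simp [sepSet], fun l hchain hlast => ?_⟩
  by_contra! havoid
  replace hchain : List.IsChain (edgeRel Ab Bb Cb) (Vertex.act i :: l) := hchain
  obtain ⟨a, ha, q, s, hq, hsq, hsY, haX⟩ : ∃ a, Bb a i = true ∧ ∃ q s,
      (∃ n, ReachIn (fun q p => Ab p q = true ∧ Vertex.st p ∉ sepSet (ns := ns) Bb Ua Ya i)
        a n q) ∧ Cb s q = true ∧ s ∉ Ya ∧ Vertex.st a ∉ sepSet (ns := ns) Bb Ua Ya i := by
    cases l with
    | nil => simp at hlast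
    | cons v l =>
      rw [List.isChain_cons_cons] at hchain
      obtain ⟨hedge, hchain⟩ := hchain
      cases v with
      | act j => exact hedge.elim
      | t => exact hedge.elim
      | sen s => exact hedge.elim
      | st a =>
        have hlast' : l.getLast? = some Vertex.t := by
          cases l with
          | nil => simp at hlast
          | cons w l => simpa using hlast
        obtain ⟨q, s, hq, hsq, hsY⟩ := exists_unattacked_sensor_of_chain l a ⟨0, .refl⟩ hchain
          hlast' fun w hw => havoid w (by simp [hw])
        exact ⟨a, hedge, q, s, hq, hsq, hsY, havoid _ (by simp)⟩
  obtain ⟨d, parent, hparent⟩ := exists_bfs_parent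
    (fun q p => Ab p q = true ∧ Vertex.st p ∉ sepSet (ns := ns) Bb Ua Ya i) a
  let R : Realization Ab Bb Cb :=
    { A := fun p q => if Ab p q = true ∧ p ≠ a ∧ q = parent p then 1 else 0
      B := fun p j => if Bb p j = true then 1 else 0
      C := fun s p => if Cb s p = true then 1 else 0
      hA := fun p q h => by simp [h]
      hB0 := fun p j h => by simp [h]
      hB1 := fun p j h => by simp [h]
      hC := fun s p h => by simp [h] }
  obtain ⟨au, ay, x, -, hx, hy, hau, hay, k, hk⟩ := hall R
  have hinput : ∀ p, Vertex.st p ∉ sepSet (ns := ns) Bb Ua Ya i → ∀ k,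
      R.B.mulVec (au k) p = if p = a then au k i else 0 := by
    intro p hp k
    rw [Matrix.mulVec, dotProduct, Finset.sum_eq_single i]
    · have hpa : Bb p i = true ↔ p = a :=
        ⟨fun h => (hstruct.1 i).unique h ha, fun h => h ▸ ha⟩
      simp [R, hpa]
    · intro j _ hj
      by_cases hjU : j ∈ Ua
      · have : Bb p j ≠ true := fun h => hp (Or.inl ⟨p, rfl, j, hjU, hj, h⟩)
        simp [R, this]
      · simp [hau k j hjU]
    · simp
  have hdelay : ∀ n p, d p = n →
      (∃ n, ReachIn (fun q p => Ab p q = true ∧ Vertex.st p ∉ sepSet (ns := ns) Bb Ua Ya i)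
        a n p) → ∃ m, ∀ k, x (k + m + 1) p = au k i := by
    intro n
    induction n using Nat.strong_induction_on with
    | _ n ih =>
      intro p hn hp
      by_cases hpa : p = a
      · subst hpa
        refine ⟨0, fun k => ?_⟩
        have h0 : R.A.mulVec (x k) p = 0 := by simp [Matrix.mulVec, dotProduct, R]
        rw [add_zero, hx, Pi.add_apply, h0, hinput p haX, if_pos rfl, zero_add]
      · obtain ⟨⟨hA, hpX⟩, hreach, hlt⟩ := hparent p hp hpa
        obtain ⟨m, hm⟩ := ih _ (hn ▸ hlt) (parent p) rfl hreach
        refine ⟨m + 1, fun k => ?_⟩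
        have hprop : R.A.mulVec (x (k + m + 1)) p = x (k + m + 1) (parent p) := by
          rw [Matrix.mulVec, dotProduct, Finset.sum_eq_single (parent p)]
          · simp [R, hA, hpa]
          · intro q _ hq
            simp [R, hq]
          · simp
        rw [← add_assoc, hx, Pi.add_apply, hprop, hinput p hpX, if_neg hpa, add_zero, hm]
  obtain ⟨m, hm⟩ := hdelay _ q rfl hq
  have hmeas : R.C.mulVec (x (k + m + 1)) s = x (k + m + 1) q := by
    rw [Matrix.mulVec, dotProduct, Finset.sum_eq_single q]
    · simp [R, hsq]
    · intro p _ hp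
      have : Cb s p ≠ true := fun h => hp ((hstruct.2.2 s).unique h hsq)
      simp [R, this]
    · simp
  have hzero := congrFun (hy (k + m + 1)) s
  rw [Pi.add_apply, hmeas, hay _ s hsY, hm, add_zero] at hzero
  exact hk hzero

/-- Proposition 3: if the (full model knowledge) attacker can conduct a perfectly
undetectable attack using `(Ua, Ya)` and active in `u_i` in every realization of the
structural model, then `|Ua| + |Ya| ≥ δ_r(u_i)`. -/
theorem attack_all_realizations_implies_deltaR_le {nx nu ns : ℕ}
    (Ab : Fin nx → Fin nx → Bool) (Bb : Fin nx → Fin nu → Bool)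
    (Cb : Fin ns → Fin nx → Bool) (P : Set (Fin ns))
    (hstruct : StructAssumption Bb Cb)
    (Ua : Finset (Fin nu)) (Ya : Finset (Fin ns)) (i : Fin nu)
    (hi : i ∈ Ua) (hYa : ∀ l ∈ Ya, l ∉ P)
    (hall : ∀ R : Realization Ab Bb Cb, PUAttack R Ua Ya i) :
    ((Ua.card + Ya.card : ℕ) : ℕ∞) ≥ deltaR Ab Bb Cb P i := by
  exact sInf_le ⟨Ua, Ya, hi, hYa, isVertexSeparator_of_forall_attack hstruct hall, by push_cast; rfl⟩
end

section
/- Let (U_a, Y_a) be sets of attacked actuators and attacked sensors with u_i ∈ U_a and Y_a ∩ P = ∅, and let X_a be the set of state vertices x_p such that [B] p k = true for some actuator u_k ∈ U_a \ {u_i}. Then there exists, for every realization (A, B, C) of the structural model, a perfectly undetectable attack using (U_a, Y_a) and active in u_i, if and only if X_a ∪ Y_a is a vertex separator of u_i and t in the extended graph G_t. -/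
/-- A spanning tree of the vertices reachable from `a`: each of them other than `a` has a
reachable predecessor of smaller rank. -/
theorem exists_predecessor_of_reflTransGen {α : Type*} (r : α → α → Prop) (a : α) :
    ∃ (d : α → ℕ) (par : α → α), ∀ v, Relation.ReflTransGen r a v → v ≠ a →
      Relation.ReflTransGen r a (par v) ∧ r (par v) v ∧ d (par v) < d v := by
  classical
  let s : ℕ → Set α := fun n => Nat.rec {a} (fun _ t => {v | ∃ u ∈ t, r u v}) n
  have hs : ∀ n, ∀ v ∈ s n, Relation.ReflTransGen r a v := by
    intro n
    induction n with
    | zero => intro v hv; rw [show v = a from hv]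
    | succ n ih => rintro v ⟨u, hu, huv⟩; exact (ih u hu).tail huv
  have hex : ∀ v, Relation.ReflTransGen r a v → ∃ n, v ∈ s n := by
    intro v hv
    induction hv with
    | refl => exact ⟨0, rfl⟩
    | tail _ h ih => obtain ⟨n, hn⟩ := ih; exact ⟨n + 1, _, hn, h⟩
  let d : α → ℕ := fun v => sInf {n | v ∈ s n}
  have key : ∀ v, ∃ u, Relation.ReflTransGen r a v → v ≠ a →
      Relation.ReflTransGen r a u ∧ r u v ∧ d u < d v := by
    intro v
    by_cases hv : Relation.ReflTransGen r a v ∧ v ≠ a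
    · have hmem : v ∈ s (d v) := Nat.sInf_mem (hex v hv.1)
      rcases hd : d v with _ | n
      · rw [hd] at hmem
        exact absurd hmem hv.2
      · rw [hd] at hmem
        obtain ⟨u, hu, huv⟩ := hmem
        exact ⟨u, fun _ _ => ⟨hs n u hu, huv, Nat.lt_succ_of_le (Nat.sInf_le hu)⟩⟩
    · exact ⟨v, fun h h' => absurd ⟨h, h'⟩ hv⟩
  choose par hpar using key
  exact ⟨d, par, hpar⟩

theorem isVertexSeparator_iff {V : Type*} (E : V → V → Prop) {a b : V} (hab : a ≠ b)
    {S : Set V} (ha : a ∉ S) (hb : b ∉ S) :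
    IsVertexSeparator E a b S ↔
      ¬ Relation.ReflTransGen (fun u v => E u v ∧ v ∉ S) a b := by
  constructor
  · rintro ⟨-, -, h⟩ hr
    have key : ∀ c, Relation.ReflTransGen (fun u v => E u v ∧ v ∉ S) c b → c ≠ b →
        ∃ l : List V, List.IsChain E (c :: l) ∧ l.getLast? = some b ∧ ∀ v ∈ l, v ∉ S := by
      intro c hc
      induction hc using Relation.ReflTransGen.head_induction_on with
      | refl => exact fun h => absurd rfl h
      | @head u v huv _ ih =>
        intro _
        by_cases hvb : v = b
        · subst hvb
          exact ⟨[v], by simpa using huv.1, rfl, by simpa using hb⟩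
        · obtain ⟨l, hl, hlast, hS⟩ := ih hvb
          refine ⟨v :: l, List.isChain_cons_cons.2 ⟨huv.1, hl⟩, ?_, ?_⟩
          · rw [List.getLast?_cons, hlast]; rfl
          · simpa using ⟨huv.2, hS⟩
    obtain ⟨l, hl, hlast, hS⟩ := key a hr hab
    obtain ⟨v, hv, hvS⟩ := h l hl hlast
    exact hS v hv hvS
  · intro h
    refine ⟨ha, hb, fun l hl hlast => ?_⟩
    by_contra! hS
    refine h ?_
    have key : ∀ (l : List V) (c : V), List.IsChain E (c :: l) → l.getLast? = some b →
        (∀ v ∈ l, v ∉ S) → Relation.ReflTransGen (fun u v => E u v ∧ v ∉ S) c b := by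
      intro l
      induction l with
      | nil => simp
      | cons v l ih =>
        intro c hl hlast hS
        rw [List.isChain_cons_cons] at hl
        have hv : E c v ∧ v ∉ S := ⟨hl.1, hS v (by simp)⟩
        refine .head hv ?_
        rcases l with _ | ⟨w, l⟩
        · obtain rfl : v = b := by simpa using hlast
          exact .refl
        · exact ih v hl.2 (by simpa using hlast) fun x hx => hS x (List.mem_cons_of_mem _ hx)
    exact key l a hl hlast hS

theorem mulVec_apply_eq_zero {m n : Type*} [Fintype n] {M : Matrix m n ℝ} {v : n → ℝ} {p : m}
    (h : ∀ q, M p q * v q = 0) : M.mulVec v p = 0 :=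
  Finset.sum_eq_zero fun q _ => h q

theorem mulVec_apply_eq_single {m n : Type*} [Fintype n] {M : Matrix m n ℝ} {v : n → ℝ}
    {p : m} (q : n) (h : ∀ q', q' ≠ q → M p q' * v q' = 0) :
    M.mulVec v p = M p q * v q :=
  Finset.sum_eq_single q (fun q' _ hq' => h q' hq') (by simp)

section StructuralModel

variable {nx nu ns : ℕ} {Ab : Fin nx → Fin nx → Bool} {Bb : Fin nx → Fin nu → Bool}
  {Cb : Fin ns → Fin nx → Bool}

theorem StructAssumption.actuator_unique (h : StructAssumption Bb Cb) {p : Fin nx}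
    {j j' : Fin nu} (hj : Bb p j = true) (hj' : Bb p j' = true) : j = j' := by
  refine h.2.1 j j' fun q => ?_
  rw [Bool.eq_iff_iff]
  exact ⟨fun hq => (h.1 j).unique hq hj ▸ hj', fun hq => (h.1 j').unique hq hj' ▸ hj⟩

/-- The edges of the extended graph whose head lies outside `X_a ∪ Y_a`. -/
def freeEdge (Ab : Fin nx → Fin nx → Bool) (Bb : Fin nx → Fin nu → Bool)
    (Cb : Fin ns → Fin nx → Bool) (Ua : Finset (Fin nu)) (Ya : Finset (Fin ns)) (i : Fin nu)
    (u v : Vertex nx nu ns) : Prop :=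
  edgeRel Ab Bb Cb u v ∧ v ∉ sepSet Bb Ua Ya i

theorem isVertexSeparator_sepSet_iff (Ua : Finset (Fin nu)) (Ya : Finset (Fin ns))
    (i : Fin nu) :
    IsVertexSeparator (edgeRel Ab Bb Cb) (Vertex.act i) Vertex.t (sepSet Bb Ua Ya i) ↔
      ¬ Relation.ReflTransGen (freeEdge Ab Bb Cb Ua Ya i) (Vertex.act i) Vertex.t :=
  isVertexSeparator_iff _ (by simp) (by simp [sepSet]) (by simp [sepSet])

theorem puAttack_of_not_reach (h : StructAssumption Bb Cb) {Ua : Finset (Fin nu)}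
    {Ya : Finset (Fin ns)} {i : Fin nu} (hi : i ∈ Ua)
    (hreach : ¬ Relation.ReflTransGen (freeEdge Ab Bb Cb Ua Ya i) (Vertex.act i) Vertex.t)
    (R : Realization Ab Bb Cb) : PUAttack R Ua Ya i := by
  classical
  choose p hp using fun j => (h.1 j).exists
  have hBp : ∀ j, R.B (p j) j ≠ 0 := fun j => R.hB1 _ _ (hp j)
  let Reach : Vertex nx nu ns → Prop :=
    Relation.ReflTransGen (freeEdge Ab Bb Cb Ua Ya i) (Vertex.act i)
  -- the input injected by `u_i` is a unit pulse, the other attacked actuators keep `X_a` at zero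
  let inp : ℕ → (Fin nx → ℝ) → Fin nu → ℝ := fun k z j =>
    if j = i then (if k = 0 then 1 else 0)
    else if j ∈ Ua then -(R.A.mulVec z (p j)) / R.B (p j) j else 0
  let x : ℕ → Fin nx → ℝ := fun n =>
    Nat.rec 0 (fun k z => R.A.mulVec z + R.B.mulVec (inp k z)) n
  have hx : ∀ k, x (k + 1) = R.A.mulVec (x k) + R.B.mulVec (inp k (x k)) := fun _ => rfl
  have hBrow : ∀ (w : Fin nu → ℝ) j, R.B.mulVec w (p j) = R.B (p j) j * w j := by
    intro w j
    refine mulVec_apply_eq_single j fun j' hj' => ?_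
    rw [R.hB0, zero_mul]
    by_contra hb
    exact hj' (h.actuator_unique (by simpa using hb) (hp j))
  have hsupp : ∀ k q, x k q ≠ 0 → Reach (Vertex.st q) := by
    intro k
    induction k with
    | zero => exact fun q hq => absurd rfl hq
    | succ k ih =>
      intro q hq
      by_cases hqS : (Vertex.st q : Vertex nx nu ns) ∈ sepSet Bb Ua Ya i
      · obtain ⟨j, hjU, hji, hj⟩ : ∃ j ∈ Ua, j ≠ i ∧ Bb q j = true := by
          simpa [sepSet] using hqS
        obtain rfl := (h.1 j).unique hj (hp j)
        refine absurd ?_ hq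
        rw [hx, Pi.add_apply, hBrow]
        simp only [inp, if_neg hji, if_pos hjU]
        field_simp [hBp j]
        ring
      by_cases hqi : Bb q i = true
      · exact .single ⟨hqi, hqS⟩
      have hB : R.B.mulVec (inp k (x k)) q = 0 := by
        refine mulVec_apply_eq_zero fun j => ?_
        by_cases hj : Bb q j = true
        · have hji : j ≠ i := fun e => hqi (e ▸ hj)
          have hjU : j ∉ Ua := fun hjU => hqS (Or.inl ⟨q, rfl, j, hjU, hji, hj⟩)
          simp [inp, hji, hjU]
        · rw [R.hB0 _ _ (by simpa using hj), zero_mul]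
      rw [hx, Pi.add_apply, hB, add_zero] at hq
      obtain ⟨q', hq'⟩ : ∃ q', R.A q q' * x k q' ≠ 0 := by
        by_contra! h0
        exact hq (mulVec_apply_eq_zero h0)
      refine (ih q' (right_ne_zero_of_mul hq')).tail ⟨?_, hqS⟩
      by_contra hA
      exact left_ne_zero_of_mul hq' (R.hA _ _ (by simpa [edgeRel] using hA))
  refine ⟨fun k => inp k (x k), fun k => -R.C.mulVec (x k), x, rfl, hx, by simp, ?_, ?_, 0, ?_⟩
  · intro k j hj
    have hji : j ≠ i := fun e => hj (e ▸ hi)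
    simp [inp, hji, hj]
  · intro k l hl
    refine neg_eq_zero.2 ?_
    refine mulVec_apply_eq_zero fun q => ?_
    by_contra hne
    have hC : Cb l q = true := by
      by_contra hC
      exact left_ne_zero_of_mul hne (R.hC _ _ (by simpa using hC))
    refine hreach (((hsupp k q (right_ne_zero_of_mul hne)).tail
      (c := Vertex.sen l) ⟨hC, ?_⟩).tail ⟨trivial, ?_⟩)
    · simpa [sepSet] using hl
    · simp [sepSet]
  · simp [inp]

theorem not_reach_of_forall_puAttack (h : StructAssumption Bb Cb) {Ua : Finset (Fin nu)}
    {Ya : Finset (Fin ns)} {i : Fin nu} (hatt : ∀ R : Realization Ab Bb Cb, PUAttack R Ua Ya i) :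
    ¬ Relation.ReflTransGen (freeEdge Ab Bb Cb Ua Ya i) (Vertex.act i) Vertex.t := by
  classical
  intro ht
  obtain ⟨d, par, hpar⟩ :=
    exists_predecessor_of_reflTransGen (freeEdge Ab Bb Cb Ua Ya i) (Vertex.act i)
  -- the realization keeps only the tree edges between states
  let R : Realization Ab Bb Cb :=
    { A := fun p q => if Ab p q = true ∧ Bb p i = false ∧ par (Vertex.st p) = Vertex.st q
        then 1 else 0
      B := fun p j => if Bb p j = true then 1 else 0
      C := fun l p => if Cb l p = true then 1 else 0
      hA := fun p q hpq => by simp [hpq]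
      hB0 := fun p j hpj => by simp [hpj]
      hB1 := fun p j hpj => by simp [hpj]
      hC := fun l p hlp => by simp [hlp] }
  obtain ⟨au, ay, x, -, hx, hy, hau, hay, k₀, hk₀⟩ := hatt R
  have hdelay : ∀ n p, d (Vertex.st p) = n →
      Relation.ReflTransGen (freeEdge Ab Bb Cb Ua Ya i) (Vertex.act i) (Vertex.st p) →
      ∃ m, ∀ k, x (k + m) p = au k i := by
    intro n
    induction n using Nat.strong_induction_on with
    | _ n ih =>
      intro p hd hp
      obtain ⟨hur, ⟨huv, hpS⟩, hdlt⟩ := hpar _ hp (by simp)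
      by_cases hpi : Bb p i = true
      · refine ⟨1, fun k => ?_⟩
        have hA : R.A.mulVec (x k) p = 0 :=
          mulVec_apply_eq_zero fun q => by simp [R, hpi]
        have hB : R.B.mulVec (au k) p = au k i := by
          refine (mulVec_apply_eq_single i fun j hj => ?_).trans (by simp [R, hpi])
          have hb : ¬ Bb p j = true := fun hb => hj (h.actuator_unique hb hpi)
          simp [R, hb]
        rw [hx, Pi.add_apply, hA, hB, zero_add]
      · cases hu : par (Vertex.st p) with
        | act j =>
          rw [hu] at hur huv
          rcases hur.cases_tail with e | ⟨w, -, hw⟩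
          · obtain rfl : i = j := by simpa using e.symm
            exact absurd huv hpi
          · cases w <;> exact hw.1.elim
        | sen l => rw [hu] at huv; exact huv.elim
        | t => rw [hu] at huv; exact huv.elim
        | st q =>
          rw [hu] at hur huv hdlt
          obtain ⟨m, hm⟩ := ih _ (hd ▸ hdlt) q rfl hur
          refine ⟨m + 1, fun k => ?_⟩
          have hA : R.A.mulVec (x (k + m)) p = x (k + m) q := by
            refine (mulVec_apply_eq_single q fun q' hq' => ?_).trans ?_
            · simp [R, hu, hq'.symm]
            · have hpq : Ab p q = true := huv
              simp [R, hu, hpq, hpi]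
          have hB : R.B.mulVec (au (k + m)) p = 0 := by
            refine mulVec_apply_eq_zero fun j => ?_
            by_cases hj : Bb p j = true
            · have hji : j ≠ i := fun e => hpi (e ▸ hj)
              have hjU : j ∉ Ua := fun hjU => hpS (Or.inl ⟨p, rfl, j, hjU, hji, hj⟩)
              rw [hau _ j hjU, mul_zero]
            · simp [R, hj]
          rw [← add_assoc, hx, Pi.add_apply, hA, hB, add_zero, hm]
  obtain ⟨l, hl⟩ : ∃ l, Relation.ReflTransGen (freeEdge Ab Bb Cb Ua Ya i) (Vertex.act i)
      (Vertex.sen l) := by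
    rcases ht.cases_tail with e | ⟨w, hw, hwt⟩
    · simp at e
    · cases w with
      | sen l => exact ⟨l, hw⟩
      | act j => exact hwt.1.elim
      | st p => exact hwt.1.elim
      | t => exact hwt.1.elim
  obtain ⟨p, hp, hpl, hlY⟩ : ∃ p, Relation.ReflTransGen (freeEdge Ab Bb Cb Ua Ya i)
      (Vertex.act i) (Vertex.st p) ∧ Cb l p = true ∧ l ∉ Ya := by
    rcases hl.cases_tail with e | ⟨w, hw, hwl⟩
    · simp at e
    · cases w with
      | st p => exact ⟨p, hw, hwl.1, fun hY => hwl.2 (Or.inr ⟨l, hY, rfl⟩)⟩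
      | act j => exact hwl.1.elim
      | sen l => exact hwl.1.elim
      | t => exact hwl.1.elim
  obtain ⟨m, hm⟩ := hdelay _ p rfl hp
  have hC : R.C.mulVec (x (k₀ + m)) l = x (k₀ + m) p := by
    refine (mulVec_apply_eq_single p fun q hq => ?_).trans (by simp [R, hpl])
    have hlq : ¬ Cb l q = true := fun hlq => hq ((h.2.2 l).unique hlq hpl)
    simp [R, hlq]
  have hyl := congrFun (hy (k₀ + m)) l
  rw [Pi.add_apply, hC, hay _ l hlY, add_zero, hm] at hyl
  exact hk₀ hyl

end StructuralModel

/-- Proposition 5 (formal content): a perfectly undetectable attack using `(Ua, Ya)` and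
active in `u_i` exists in every realization of the structural model if and only if
`X_a ∪ Y_a` is a vertex separator of `u_i` and `t` in the extended graph. -/
theorem attack_all_realizations_iff_separator {nx nu ns : ℕ}
    (Ab : Fin nx → Fin nx → Bool) (Bb : Fin nx → Fin nu → Bool)
    (Cb : Fin ns → Fin nx → Bool) (P : Set (Fin ns))
    (hstruct : StructAssumption Bb Cb)
    (Ua : Finset (Fin nu)) (Ya : Finset (Fin ns)) (i : Fin nu)
    (hi : i ∈ Ua) (hYa : ∀ l ∈ Ya, l ∉ P) :
    (∀ R : Realization Ab Bb Cb, PUAttack R Ua Ya i) ↔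
      IsVertexSeparator (edgeRel Ab Bb Cb) (Vertex.act i) Vertex.t
        (sepSet Bb Ua Ya i) := by
  rw [isVertexSeparator_sepSet_iff]
  exact ⟨not_reach_of_forall_puAttack hstruct, puAttack_of_not_reach hstruct hi⟩
end

section
/- Let u_i be an actuator and Y_a a set of sensors with Y_a ∩ P = ∅. If for every realization (A, B, C) of the structural model there exists a perfectly undetectable attack using ({u_i}, Y_a) and active in u_i, then Y_a (viewed as a set of sensor vertices) is a vertex separator of u_i and t in the extended graph G_t, and consequently |Y_a| ≥ δ_r(u_i) − 1. In particular, if δ_r(u_i) = +∞, then no such set Y_a exists. -/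
/-- The endpoints of a relation path are joined by a path that visits no vertex twice. -/
theorem exists_injOn_path_of_reflTransGen {V : Type*} {r : V → V → Prop} {a b : V}
    (h : Relation.ReflTransGen r a b) :
    ∃ (m : ℕ) (v : ℕ → V), v 0 = a ∧ v m = b ∧ (∀ k < m, r (v k) (v (k + 1))) ∧
      Set.InjOn v (Set.Iic m) := by
  classical
  have hex : ∃ (m : ℕ) (v : ℕ → V), v 0 = a ∧ v m = b ∧ ∀ k < m, r (v k) (v (k + 1)) := by
    induction h with
    | refl => exact ⟨0, fun _ => a, rfl, rfl, by simp⟩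
    | @tail b c _ hbc ih =>
      obtain ⟨m, v, h0, hm, hv⟩ := ih
      refine ⟨m + 1, fun k => if k ≤ m then v k else c, by simpa using h0, by simp, ?_⟩
      intro k hk
      rcases Nat.lt_succ_iff_lt_or_eq.mp hk with hk | rfl
      · simpa [hk.le, Nat.succ_le_of_lt hk] using hv k hk
      · simpa [hm] using hbc
  obtain ⟨v, h0, hm, hv⟩ := Nat.find_spec hex
  have hne : ∀ c d, c < d → d ≤ Nat.find hex → v c ≠ v d := by
    intro c d hcd hd heq
    refine Nat.find_min hex (m := Nat.find hex - (d - c)) (by omega)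
      ⟨fun k => if k ≤ c then v k else v (k + (d - c)), by simpa using h0, ?_, ?_⟩
    · by_cases hle : Nat.find hex - (d - c) ≤ c
      · have hc : Nat.find hex - (d - c) = c := by omega
        have hd' : d = Nat.find hex := by omega
        rw [hc]
        simpa [heq, ← hd'] using hd' ▸ hm
      · simp only [hle, if_false]
        rwa [Nat.sub_add_cancel (by omega)]
    · intro k hk
      rcases lt_trichotomy k c with hkc | rfl | hkc
      · simpa [hkc.le, Nat.succ_le_of_lt hkc] using hv k (by omega)
      · have hstep := hv d (by omega)
        have : k + 1 + (d - k) = d + 1 := by omega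
        simpa [heq, this] using hstep
      · have hstep := hv (k + (d - c)) (by omega)
        have : k + 1 + (d - c) = k + (d - c) + 1 := by omega
        simpa [this, show ¬ k ≤ c by omega, show ¬ k + 1 ≤ c by omega] using hstep
  refine ⟨_, v, h0, hm, hv, ?_⟩
  intro c hc d hd heq
  rcases lt_trichotomy c d with h | h | h
  · exact absurd heq (hne c d h hd)
  · exact h
  · exact absurd heq.symm (hne d c h hc)

/-- A path in `G_t` from a state to `t` follows state edges, then passes through a sensor. -/
theorem exists_sensor_of_chain {nx nu ns : ℕ} {Ab : Fin nx → Fin nx → Bool}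
    {Bb : Fin nx → Fin nu → Bool} {Cb : Fin ns → Fin nx → Bool} (l : List (Vertex nx nu ns)) :
    ∀ p : Fin nx, List.IsChain (edgeRel Ab Bb Cb) (Vertex.st p :: l) →
      l.getLast? = some Vertex.t →
      ∃ q s, Relation.ReflTransGen (fun a b => Ab b a = true) p q ∧ Cb s q = true ∧
        Vertex.sen s ∈ l := by
  induction l with
  | nil => simp
  | cons w l ih =>
    intro p hc hl
    rw [List.isChain_cons_cons] at hc
    obtain ⟨hpw, hc⟩ := hc
    match w, hpw with
    | Vertex.st p', hpw =>
      have hl' : l.getLast? = some Vertex.t := by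
        cases l with
        | nil => simp at hl
        | cons w' l => simpa [List.getLast?_cons_cons] using hl
      obtain ⟨q, s, hq, hs, hmem⟩ := ih p' hc hl'
      exact ⟨q, s, Relation.ReflTransGen.head hpw hq, hs, List.mem_cons_of_mem _ hmem⟩
    | Vertex.sen s, hpw => exact ⟨p, s, Relation.ReflTransGen.refl, hpw, List.mem_cons_self⟩

/-- If the state driven by `u_i` is joined by a path to the state measured by a sensor `y_s`
outside `Ya`, then some realization admits no perfectly undetectable attack using `u_i` and
`Ya`. -/
theorem exists_realization_not_puAttack {nx nu ns : ℕ} {Ab : Fin nx → Fin nx → Bool}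
    {Bb : Fin nx → Fin nu → Bool} {Cb : Fin ns → Fin nx → Bool}
    (hstruct : StructAssumption Bb Cb) {Ya : Finset (Fin ns)} {i : Fin nu} {p q : Fin nx}
    {s : Fin ns} (hp : Bb p i = true)
    (hpq : Relation.ReflTransGen (fun a b => Ab b a = true) p q) (hs : Cb s q = true)
    (hsY : s ∉ Ya) : ∃ R : Realization Ab Bb Cb, ¬ PUAttack R {i} Ya i := by
  classical
  obtain ⟨m, v, h0, hm, hv, hinj⟩ := exists_injOn_path_of_reflTransGen hpq
  have hBi : ∀ r, Bb r i = true ↔ r = p := fun r =>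
    ⟨fun hr => (hstruct.1 i).unique hr hp, fun hr => hr ▸ hp⟩
  have hCs : ∀ r, Cb s r = true ↔ r = q := fun r =>
    ⟨fun hr => (hstruct.2.2 s).unique hr hs, fun hr => hr ▸ hs⟩
  refine ⟨{ A := fun a b => if ∃ k < m, a = v (k + 1) ∧ b = v k then 1 else 0
            B := fun a j => if Bb a j = true then 1 else 0
            C := fun l a => if Cb l a = true then 1 else 0
            hA := ?_, hB0 := ?_, hB1 := ?_, hC := ?_ }, ?_⟩
  · intro a b hab
    refine if_neg ?_
    rintro ⟨k, hk, rfl, rfl⟩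
    simp [hv k hk] at hab
  · intro a j h; simp [h]
  · intro a j h; simp [h]
  · intro l a h; simp [h]
  rintro ⟨au, ay, x, -, hx, hy, hau, hay, j, hj⟩
  have hBu : ∀ k a, Matrix.mulVec (fun a j => if Bb a j = true then (1 : ℝ) else 0 :
      Matrix (Fin nx) (Fin nu) ℝ) (au k) a = if a = p then au k i else 0 := by
    intro k a
    simp only [Matrix.mulVec, dotProduct]
    rw [Finset.sum_eq_single i]
    · simp [hBi]
    · intro j _ hji
      simp [hau k j (by simpa using hji)]
    · simp
  have hq : ∀ k, x k q = 0 := by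
    intro k
    have := congrFun (hy k) s
    simpa [Matrix.mulVec, dotProduct, hay k s hsY, hCs] using this
  have hsource : ∀ k, x (k + 1) (v 0) = au k i := by
    intro k
    have hrow : ∀ b, ¬ ∃ n < m, v 0 = v (n + 1) ∧ b = v n := by
      rintro b ⟨n, hn, hvn, -⟩
      exact Nat.succ_ne_zero n
        (hinj (Set.mem_Iic.mpr hn) (Set.mem_Iic.mpr (Nat.zero_le m)) hvn.symm)
    rw [hx k, Pi.add_apply, hBu, if_pos h0]
    simp [Matrix.mulVec, dotProduct, hrow]
  have hshift : ∀ n < m, ∀ k, x (k + 1) (v (n + 1)) = x k (v n) := by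
    intro n hn k
    have hrow : ∀ b, (∃ n' < m, v (n + 1) = v (n' + 1) ∧ b = v n') ↔ b = v n := by
      refine fun b => ⟨?_, fun hb => ⟨n, hn, rfl, hb⟩⟩
      rintro ⟨n', hn', hvn, rfl⟩
      rw [Nat.succ_injective (hinj (Set.mem_Iic.mpr hn) (Set.mem_Iic.mpr hn') hvn)]
    have hne : v (n + 1) ≠ p := by
      rw [← h0]
      exact fun h => Nat.succ_ne_zero n
        (hinj (Set.mem_Iic.mpr hn) (Set.mem_Iic.mpr (Nat.zero_le m)) h)
    rw [hx k, Pi.add_apply, hBu, if_neg hne]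
    simp [Matrix.mulVec, dotProduct, hrow]
  have hzero : ∀ n ≤ m, ∀ k, x k (v n) = 0 := by
    intro n hn
    induction hn using Nat.decreasingInduction with
    | self => simpa [hm] using hq
    | of_succ n hn ih => exact fun k => (hshift n hn k).symm.trans (ih (k + 1))
  exact hj ((hsource j).symm.trans (hzero 0 (Nat.zero_le m) (j + 1)))

/-- Proposition 6: if the attacker controlling only actuator `u_i` and sensors `Ya` can
conduct a perfectly undetectable attack active in `u_i` in every realization of the
structural model, then `Ya` is a vertex separator of `u_i` and `t` in the extended graph,
so `|Ya| ≥ δ_r(u_i) - 1`; in particular `δ_r(u_i) ≠ +∞`. -/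
theorem sensor_only_attack_all_realizations {nx nu ns : ℕ}
    (Ab : Fin nx → Fin nx → Bool) (Bb : Fin nx → Fin nu → Bool)
    (Cb : Fin ns → Fin nx → Bool) (P : Set (Fin ns))
    (hstruct : StructAssumption Bb Cb)
    (Ya : Finset (Fin ns)) (i : Fin nu) (hYa : ∀ l ∈ Ya, l ∉ P)
    (hall : ∀ R : Realization Ab Bb Cb, PUAttack R {i} Ya i) :
    IsVertexSeparator (edgeRel Ab Bb Cb) (Vertex.act i) Vertex.t
      {v : Vertex nx nu ns | ∃ l ∈ Ya, v = Vertex.sen l} ∧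
    ((Ya.card : ℕ) : ℕ∞) ≥ deltaR Ab Bb Cb P i - 1 ∧
    deltaR Ab Bb Cb P i ≠ ⊤ := by
  have hsep : IsVertexSeparator (edgeRel Ab Bb Cb) (Vertex.act i) Vertex.t
      {v : Vertex nx nu ns | ∃ l ∈ Ya, v = Vertex.sen l} := by
    refine ⟨by simp, by simp, fun l hc hl => ?_⟩
    match l, hc, hl with
    | w :: l, hc, hl =>
      obtain ⟨hw, hc⟩ := List.isChain_cons_cons.mp hc
      match w, hw with
      | Vertex.st p, hw =>
        have hl' : l.getLast? = some Vertex.t := by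
          cases l with
          | nil => simp at hl
          | cons w' l => simpa [List.getLast?_cons_cons] using hl
        obtain ⟨q, s, hpq, hs, hmem⟩ := exists_sensor_of_chain l p hc hl'
        by_cases hsY : s ∈ Ya
        · exact ⟨Vertex.sen s, List.mem_cons_of_mem _ hmem, s, hsY, rfl⟩
        · obtain ⟨R, hR⟩ := exists_realization_not_puAttack hstruct hw hpq hs hsY
          exact absurd (hall R) hR
  have hset : sepSet Bb {i} Ya i = {v : Vertex nx nu ns | ∃ l ∈ Ya, v = Vertex.sen l} := by
    ext v
    simp [sepSet]
  have hle : deltaR Ab Bb Cb P i ≤ (Ya.card : ℕ∞) + 1 :=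
    sInf_le ⟨{i}, Ya, Finset.mem_singleton_self i, hYa, hset ▸ hsep, by simp [add_comm]⟩
  exact ⟨hsep, tsub_le_iff_right.mpr hle,
    ne_top_of_le_ne_top (ENat.natCast_ne_top (Ya.card + 1)) hle⟩
end

section
/- Let u_i be an actuator with δ_r(u_i) ≠ +∞ and let x_m ∈ X_{u_i}. Extend the structural model by placing one new sensor y_new measuring x_m (i.e., [C] gains one new row equal to the standard basis vector e_m), and let δ_r'(u_i) denote the robust security index of u_i in the extended model. Then: (1) if y_new is protected (added to P), δ_r'(u_i) = +∞; (2) if y_new is unprotected, δ_r'(u_i) = δ_r(u_i) + 1. -/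
/-- Extend the structural output matrix `[C]` with one new sensor row measuring state
`xm` (the new row is the standard basis vector `e_{xm}`). -/
def extendC {nx ns : ℕ} (Cb : Fin ns → Fin nx → Bool) (xm : Fin nx) :
    Fin (ns + 1) → Fin nx → Bool :=
  fun l p => if h : (l : ℕ) < ns then Cb ⟨l, h⟩ p else decide (p = xm)

/-- The original protected sensors, viewed inside the extended sensor index set. -/
def liftP {ns : ℕ} (P : Set (Fin ns)) : Set (Fin (ns + 1)) :=
  {l | ∃ l0 ∈ P, l = Fin.castSucc l0}

/-- The set `X_{u_i}` of states `x_k` reachable from `u_i` by a directed path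
`u_i, x_{j_1}, …, x_k` in the extended graph on which no state is adjacent to an actuator
other than `u_i`. -/
def XSet {nx nu : ℕ} (Ab : Fin nx → Fin nx → Bool) (Bb : Fin nx → Fin nu → Bool)
    (i : Fin nu) : Set (Fin nx) :=
  {xk | ∃ l : List (Fin nx),
    l.getLast? = some xk ∧
    (∃ h, l.head? = some h ∧ Bb h i = true) ∧
    List.Chain' (fun q p => Ab p q) l ∧
    (∀ p ∈ l, ∀ j : Fin nu, j ≠ i → Bb p j = false)}

section HelperLemmas

variable {nx nu ns : ℕ}

theorem List.IsChain.cons_map_of_forall_mem {V W : Type*} {E : V → V → Prop} {E' : W → W → Prop}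
    {p : V → Prop} (f : V → W) (hf : ∀ x y, p x → p y → E x y → E' (f x) (f y)) {a : V}
    {l : List V} (h : List.IsChain E (a :: l)) (ha : p a) (hl : ∀ v ∈ l, p v) :
    List.IsChain E' (f a :: l.map f) := by
  induction l generalizing a with
  | nil => simp
  | cons b l ih =>
    rw [List.isChain_cons_cons] at h
    simp only [List.map_cons, List.isChain_cons_cons]
    have hb : p b := hl b (by simp)
    exact ⟨hf a b ha hb h.1, ih h.2 hb fun v hv => hl v (by simp [hv])⟩

/-- The inclusion of the vertices of the extended graph into those of the graph with one
additional sensor. -/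
def Vertex.castSucc : Vertex nx nu ns → Vertex nx nu (ns + 1)
  | .act j => .act j
  | .st p => .st p
  | .sen l => .sen l.castSucc
  | .t => .t

/-- The left inverse of `Vertex.castSucc` that sends the additional sensor to the sink. -/
def Vertex.dropLast : Vertex nx nu (ns + 1) → Vertex nx nu ns
  | .act j => .act j
  | .st p => .st p
  | .sen l => if h : (l : ℕ) < ns then .sen ⟨l, h⟩ else .t
  | .t => .t

theorem extendC_castSucc (Cb : Fin ns → Fin nx → Bool) (xm p : Fin nx) (l : Fin ns) :
    extendC Cb xm l.castSucc p = Cb l p := by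
  simp [extendC]

theorem extendC_last (Cb : Fin ns → Fin nx → Bool) (xm : Fin nx) :
    extendC Cb xm (Fin.last ns) xm = true := by
  simp [extendC]

variable {Ab : Fin nx → Fin nx → Bool} {Bb : Fin nx → Fin nu → Bool}
  {Cb : Fin ns → Fin nx → Bool} {xm : Fin nx} {i : Fin nu}

theorem edgeRel_castSucc {v w : Vertex nx nu ns} (h : edgeRel Ab Bb Cb v w) :
    edgeRel Ab Bb (extendC Cb xm) v.castSucc w.castSucc := by
  cases v <;> cases w <;> simp_all [edgeRel, Vertex.castSucc, extendC_castSucc]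

theorem edgeRel_dropLast {v w : Vertex nx nu (ns + 1)} (hv : v ≠ .sen (Fin.last ns))
    (hw : w ≠ .sen (Fin.last ns)) (h : edgeRel Ab Bb (extendC Cb xm) v w) :
    edgeRel Ab Bb Cb v.dropLast w.dropLast := by
  rcases v with j | p | l | _ <;> rcases w with j' | p' | l' | _ <;>
    try induction l using Fin.lastCases
  all_goals try induction l' using Fin.lastCases
  all_goals simp_all [edgeRel, Vertex.dropLast, extendC_castSucc]

theorem last_mem_of_isVertexSeparator {Ua : Finset (Fin nu)} {Ya : Finset (Fin (ns + 1))}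
    (hxm : xm ∈ XSet Ab Bb i)
    (h : IsVertexSeparator (edgeRel Ab Bb (extendC Cb xm)) (.act i) .t (sepSet Bb Ua Ya i)) :
    Fin.last ns ∈ Ya := by
  obtain ⟨l, hlast, ⟨x, hx, hxi⟩, hch, hl⟩ := hxm
  obtain ⟨v, hv, hvS⟩ := h.2.2
    (l.map Vertex.st ++ [Vertex.sen (Fin.last ns), Vertex.t]) (by
      change List.IsChain _ (([Vertex.act i] ++ l.map Vertex.st) ++ _)
      have hch' : List.IsChain (fun q p => Ab p q = true) l := hch
      refine List.IsChain.append (List.IsChain.append (by simp) ?_ ?_) (by simp [edgeRel]) ?_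
      · exact (List.isChain_map _).2 hch'
      · simp [hx, edgeRel, hxi]
      · rw [List.getLast?_append, List.getLast?_map, hlast]
        simp [edgeRel, extendC_last]) (by simp)
  rcases hvS with ⟨p, rfl, k, -, hki, hB⟩ | ⟨y, hy, rfl⟩
  · have hp : p ∈ l := by simpa using hv
    simp [hl p hp k hki] at hB
  · have hy' : y = Fin.last ns := by simpa using hv
    exact hy' ▸ hy

theorem act_notMem_sepSet {Ua : Finset (Fin nu)} {Ya : Finset (Fin ns)} {j : Fin nu} :
    Vertex.act j ∉ sepSet Bb Ua Ya i := by
  simp [sepSet]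

theorem t_notMem_sepSet {Ua : Finset (Fin nu)} {Ya : Finset (Fin ns)} :
    Vertex.t ∉ sepSet Bb Ua Ya i := by
  simp [sepSet]

theorem isVertexSeparator_of_extendC {Ua : Finset (Fin nu)} {Ya : Finset (Fin ns)}
    (h : IsVertexSeparator (edgeRel Ab Bb (extendC Cb xm)) (.act i) .t
      (sepSet Bb Ua (insert (Fin.last ns) (Ya.map Fin.castSuccEmb)) i)) :
    IsVertexSeparator (edgeRel Ab Bb Cb) (.act i) .t (sepSet Bb Ua Ya i) := by
  refine ⟨act_notMem_sepSet, t_notMem_sepSet, fun l hl hlt => ?_⟩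
  obtain ⟨v, hv, hvS⟩ := h.2.2 (l.map Vertex.castSucc)
    (List.IsChain.cons_map_of_forall_mem (p := fun _ => True) Vertex.castSucc
      (fun _ _ _ _ => edgeRel_castSucc) hl trivial fun _ _ => trivial)
    (by simp [hlt, Vertex.castSucc])
  obtain ⟨w, hw, rfl⟩ := List.mem_map.1 hv
  refine ⟨w, hw, ?_⟩
  cases w <;> simp_all [sepSet, Vertex.castSucc]

theorem isVertexSeparator_extendC {Ua : Finset (Fin nu)} {Ya : Finset (Fin ns)}
    (h : IsVertexSeparator (edgeRel Ab Bb Cb) (.act i) .t (sepSet Bb Ua Ya i)) :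
    IsVertexSeparator (edgeRel Ab Bb (extendC Cb xm)) (.act i) .t
      (sepSet Bb Ua (insert (Fin.last ns) (Ya.map Fin.castSuccEmb)) i) := by
  refine ⟨act_notMem_sepSet, t_notMem_sepSet, fun l hl hlt => ?_⟩
  by_cases hlast : Vertex.sen (Fin.last ns) ∈ l
  · exact ⟨_, hlast, by simp [sepSet]⟩
  have hne : ∀ v ∈ l, v ≠ Vertex.sen (Fin.last ns) := fun v hv hv' => hlast (hv' ▸ hv)
  obtain ⟨v, hv, hvS⟩ := h.2.2 (l.map Vertex.dropLast)
    (List.IsChain.cons_map_of_forall_mem (p := (· ≠ Vertex.sen (Fin.last ns))) Vertex.dropLast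
      (fun _ _ => edgeRel_dropLast) hl (by simp) hne)
    (by simp [hlt, Vertex.dropLast])
  obtain ⟨w, hw, rfl⟩ := List.mem_map.1 hv
  refine ⟨w, hw, ?_⟩
  rcases w with j | p | y | _
  · exact absurd hvS act_notMem_sepSet
  · simpa [sepSet, Vertex.dropLast] using hvS
  · induction y using Fin.lastCases with
    | last => exact absurd hw hlast
    | cast y => simpa [sepSet, Vertex.dropLast] using hvS
  · exact absurd hvS t_notMem_sepSet

theorem exists_eq_insert_last_map {Y : Finset (Fin (ns + 1))} (h : Fin.last ns ∈ Y) :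
    ∃ Z : Finset (Fin ns), Y = insert (Fin.last ns) (Z.map Fin.castSuccEmb) := by
  refine ⟨Finset.univ.filter fun y => y.castSucc ∈ Y, ?_⟩
  ext y
  induction y using Fin.lastCases with
  | last => simp [h]
  | cast y => simp

theorem card_insert_last_map (Z : Finset (Fin ns)) :
    (insert (Fin.last ns) (Z.map Fin.castSuccEmb)).card = Z.card + 1 := by
  rw [Finset.card_insert_of_notMem (by simp), Finset.card_map]

theorem castSucc_mem_liftP {P : Set (Fin ns)} {y : Fin ns} :
    y.castSucc ∈ liftP P ↔ y ∈ P := by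
  simp [liftP]

theorem last_notMem_liftP {P : Set (Fin ns)} : Fin.last ns ∉ liftP P := by
  rintro ⟨y, -, hy⟩
  exact Fin.castSucc_ne_last y hy.symm

theorem deltaR_le {P : Set (Fin ns)} {Ua : Finset (Fin nu)} {Ya : Finset (Fin ns)} (hi : i ∈ Ua)
    (hY : ∀ l ∈ Ya, l ∉ P)
    (h : IsVertexSeparator (edgeRel Ab Bb Cb) (.act i) .t (sepSet Bb Ua Ya i)) :
    deltaR Ab Bb Cb P i ≤ Ua.card + Ya.card :=
  sInf_le ⟨Ua, Ya, hi, hY, h, rfl⟩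

theorem deltaR_eq_card_add_card {P : Set (Fin ns)} (h : deltaR Ab Bb Cb P i ≠ ⊤) :
    ∃ (Ua : Finset (Fin nu)) (Ya : Finset (Fin ns)), i ∈ Ua ∧ (∀ l ∈ Ya, l ∉ P) ∧
      IsVertexSeparator (edgeRel Ab Bb Cb) (.act i) .t (sepSet Bb Ua Ya i) ∧
      deltaR Ab Bb Cb P i = Ua.card + Ya.card :=
  csInf_mem (Set.nonempty_iff_ne_empty.2 fun he => h ((congrArg sInf he).trans sInf_empty))

end HelperLemmas

/-- Theorem 4 (first part): let `u_i` have finite robust security index and let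
`xm ∈ X_{u_i}`. Placing one new sensor measuring `xm`:
(1) if the new sensor is protected, the robust index of `u_i` becomes `+∞`;
(2) if the new sensor is unprotected, the robust index of `u_i` increases by exactly one. -/
theorem deltaR_new_sensor_on_XSet {nx nu ns : ℕ}
    (Ab : Fin nx → Fin nx → Bool) (Bb : Fin nx → Fin nu → Bool)
    (Cb : Fin ns → Fin nx → Bool) (P : Set (Fin ns))
    (hstruct : StructAssumption Bb Cb) (i : Fin nu)
    (hfin : deltaR Ab Bb Cb P i ≠ ⊤)
    (xm : Fin nx) (hxm : xm ∈ XSet Ab Bb i) :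
    deltaR Ab Bb (extendC Cb xm) (liftP P ∪ {Fin.last ns}) i = ⊤ ∧
    deltaR Ab Bb (extendC Cb xm) (liftP P) i = deltaR Ab Bb Cb P i + 1 := by
  constructor
  · by_contra hne
    obtain ⟨Ua, Ya, -, hY, hsep, -⟩ := deltaR_eq_card_add_card hne
    exact hY _ (last_mem_of_isVertexSeparator hxm hsep) (Or.inr rfl)
  · apply le_antisymm
    · obtain ⟨Ua, Ya, hi, hY, hsep, hcard⟩ := deltaR_eq_card_add_card hfin
      refine (deltaR_le hi ?_ (isVertexSeparator_extendC hsep)).trans_eq ?_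
      · intro y hy
        rcases Finset.mem_insert.1 hy with rfl | hy
        · exact last_notMem_liftP
        · obtain ⟨z, hz, rfl⟩ := Finset.mem_map.1 hy
          exact fun hP => hY z hz (castSucc_mem_liftP.1 hP)
      · rw [hcard, card_insert_last_map, Nat.cast_add_one, add_assoc]
    · by_contra! hlt
      obtain ⟨Ua, Ya, hi, hY, hsep, hcard⟩ := deltaR_eq_card_add_card hlt.ne_top
      obtain ⟨Z, rfl⟩ := exists_eq_insert_last_map (last_mem_of_isVertexSeparator hxm hsep)
      rw [hcard, card_insert_last_map, Nat.cast_add_one, ← add_assoc] at hlt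
      refine hlt.not_ge (add_le_add_left (deltaR_le hi ?_ (isVertexSeparator_of_extendC hsep)) 1)
      exact fun z hz hP => hY z.castSucc (by simp [hz]) (castSucc_mem_liftP.2 hP)
end

section
/- Let U and Y_s be finite types, let w : U → Y_s → ℝ satisfy w u y ∈ {0, 1} for all u and y, and let k : U → ℕ. For Y_p : Finset Y_s define G(Y_p) = Σ_{u ∈ U} min (Σ_{y ∈ Y_p} w u y) (k u). Then G is submodular, nondecreasing, integer-valued, and G(∅) = 0 (so the unprotected-sensor placement problem 'minimize |Y_p| subject to G(Y_p) ≥ Σ_{u} k u' is an instance of the submodular covering problem (5)). -/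
/-- A set function `F` on a finite type is submodular if
`F (insert x A) - F A ≥ F (insert x B) - F B` for all `A ⊆ B` and `x ∉ B`. -/
def Submodular {E : Type*} [DecidableEq E] (F : Finset E → ℝ) : Prop :=
  ∀ A B : Finset E, A ⊆ B → ∀ x ∉ B, F (insert x A) - F A ≥ F (insert x B) - F B

/-- A set function `F` is nondecreasing if `A ⊆ B` implies `F A ≤ F B`. -/
def Nondecreasing {E : Type*} (F : Finset E → ℝ) : Prop :=
  ∀ A B : Finset E, A ⊆ B → F A ≤ F B

/-- The gain function of the unprotected-sensor placement problem:
`G(Yp) = Σ_u min (Σ_{y ∈ Yp} w u y) (k u)`. -/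
noncomputable def sensorGain {U Y : Type*} [Fintype U] (w : U → Y → ℝ) (k : U → ℕ)
    (Yp : Finset Y) : ℝ :=
  ∑ u : U, min (∑ y ∈ Yp, w u y) (k u : ℝ)

/-- For nonnegative weights the gain function is submodular. -/
theorem submodular_sensorGain_of_nonneg {U Y : Type*} [Fintype U] [DecidableEq Y]
    (w : U → Y → ℝ) (hw : ∀ u y, 0 ≤ w u y) (k : U → ℕ) : Submodular (sensorGain w k) := by
  intro A B hAB x hx
  have hxA : x ∉ A := fun h => hx (hAB h)
  simp only [sensorGain, ← Finset.sum_sub_distrib, Finset.sum_insert hx, Finset.sum_insert hxA]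
  refine Finset.sum_le_sum fun u _ => ?_
  have hS : ∑ y ∈ A, w u y ≤ ∑ y ∈ B, w u y :=
    Finset.sum_le_sum_of_subset_of_nonneg hAB fun y _ _ => hw u y
  have := hw u x
  grind

/-- For nonnegative weights the gain function is nondecreasing. -/
theorem nondecreasing_sensorGain_of_nonneg {U Y : Type*} [Fintype U]
    (w : U → Y → ℝ) (hw : ∀ u y, 0 ≤ w u y) (k : U → ℕ) : Nondecreasing (sensorGain w k) :=
  fun _ _ hAB => Finset.sum_le_sum fun u _ => min_le_min_right _ <|
    Finset.sum_le_sum_of_subset_of_nonneg hAB fun y _ _ => hw u y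

/-- For integer weights the gain function is integer valued. -/
theorem sensorGain_intCast {U Y : Type*} [Fintype U] (v : U → Y → ℤ) (k : U → ℕ)
    (Yp : Finset Y) :
    sensorGain (fun u y => (v u y : ℝ)) k Yp =
      ((∑ u : U, min (∑ y ∈ Yp, v u y) (k u : ℤ) : ℤ) : ℝ) := by
  simp [sensorGain]

theorem sensorGain_empty {U Y : Type*} [Fintype U] (w : U → Y → ℝ) (k : U → ℕ) :
    sensorGain w k ∅ = 0 := by
  simp [sensorGain]

/-- Proposition 7: with binary weights `w`, the gain function `G` of the
unprotected-sensor placement problem is submodular, nondecreasing, integer valued, and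
satisfies `G ∅ = 0`. -/
theorem sensorGain_submodular {U Y : Type*} [Fintype U] [Fintype Y] [DecidableEq Y]
    (w : U → Y → ℝ) (hw : ∀ u y, w u y = 0 ∨ w u y = 1) (k : U → ℕ) :
    Submodular (sensorGain w k) ∧ Nondecreasing (sensorGain w k) ∧
    (∀ Yp : Finset Y, ∃ z : ℤ, sensorGain w k Yp = (z : ℝ)) ∧
    sensorGain w k (∅ : Finset Y) = 0 := by
  have hnonneg : ∀ u y, 0 ≤ w u y := fun u y => by
    rcases hw u y with h | h <;> simp [h]
  have hint : ∀ u y, ∃ z : ℤ, w u y = z := fun u y => by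
    rcases hw u y with h | h
    · exact ⟨0, by simp [h]⟩
    · exact ⟨1, by simp [h]⟩
  choose v hv using hint
  obtain rfl : w = fun u y => (v u y : ℝ) := funext₂ hv
  exact ⟨submodular_sensorGain_of_nonneg _ hnonneg k, nondecreasing_sensorGain_of_nonneg _ hnonneg k,
    fun Yp => ⟨_, sensorGain_intCast v k Yp⟩, sensorGain_empty _ k⟩
end
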